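/- arXiv:math/0611358 — 3 statements merged into one kernel-verified Lean document; each statement's English description precedes it below -/
import Mathlib

section
/- A ring R is quasi-Frobenius if and only if every left R-module is Gorenstein projective (i.e., the left Gorenstein global dimension of R is zero). -/
/-! Definitions for Gorenstein homological algebra over an arbitrary
associative ring `R` (left modules; right modules are `Rᵐᵒᵖ`-modules). -/

universe u

section Defs

variable (R : Type u) [Ring R]

/-- `0 → A → B → C → 0` is a short exact sequence. -/
def IsSES {A B C : Type u} [AddCommGroup A] [Module R A] [AddCommGroup B] [Module R B]
    [AddCommGroup C] [Module R C] (f : A →ₗ[R] B) (g : B →ₗ[R] C) : Prop :=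
  Function.Injective f ∧ Function.Exact f g ∧ Function.Surjective g

/-- `M` is Gorenstein projective: it is the kernel of a map in a doubly infinite exact
complex of projective modules which stays exact under `Hom_R(-, Q)` for every projective `Q`. -/
def GorensteinProjective (M : Type u) [AddCommGroup M] [Module R M] : Prop :=
  ∃ (P : ℤ → Type u) (_ : ∀ i, AddCommGroup (P i)) (_ : ∀ i, Module R (P i))
    (d : ∀ i, P i →ₗ[R] P (i + 1)),
      (∀ i, Module.Projective R (P i)) ∧
      (∀ i, Function.Exact (d i) (d (i + 1))) ∧
      Nonempty (M ≃ₗ[R] LinearMap.ker (d 0)) ∧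
      (∀ (Q : Type u) (_ : AddCommGroup Q) (_ : Module R Q), Module.Projective R Q →
        ∀ i, Function.Exact (fun g : P (i + 1 + 1) →ₗ[R] Q => g.comp (d (i + 1)))
          (fun g : P (i + 1) →ₗ[R] Q => g.comp (d i)))

/-- `M` is strongly Gorenstein projective: there is a complete projective resolution
with a single projective module `P` and a single map `f`. -/
def StronglyGorensteinProjective (M : Type u) [AddCommGroup M] [Module R M] : Prop :=
  ∃ (P : Type u) (_ : AddCommGroup P) (_ : Module R P) (f : P →ₗ[R] P),
    Module.Projective R P ∧
    Function.Exact f f ∧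
    Nonempty (M ≃ₗ[R] LinearMap.ker f) ∧
    (∀ (Q : Type u) (_ : AddCommGroup Q) (_ : Module R Q), Module.Projective R Q →
      Function.Exact (fun g : P →ₗ[R] Q => g.comp f) (fun g : P →ₗ[R] Q => g.comp f))

/-- `M` is Gorenstein injective (dual to Gorenstein projective). -/
def GorensteinInjective (M : Type u) [AddCommGroup M] [Module R M] : Prop :=
  ∃ (I : ℤ → Type u) (_ : ∀ i, AddCommGroup (I i)) (_ : ∀ i, Module R (I i))
    (d : ∀ i, I i →ₗ[R] I (i + 1)),
      (∀ i, Module.Injective R (I i)) ∧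
      (∀ i, Function.Exact (d i) (d (i + 1))) ∧
      Nonempty (M ≃ₗ[R] LinearMap.ker (d 0)) ∧
      (∀ (E : Type u) (_ : AddCommGroup E) (_ : Module R E), Module.Injective R E →
        ∀ i, Function.Exact (fun g : E →ₗ[R] I i => (d i).comp g)
          (fun g : E →ₗ[R] I (i + 1) => (d (i + 1)).comp g))

/-- `M` is strongly Gorenstein injective. -/
def StronglyGorensteinInjective (M : Type u) [AddCommGroup M] [Module R M] : Prop :=
  ∃ (I : Type u) (_ : AddCommGroup I) (_ : Module R I) (f : I →ₗ[R] I),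
    Module.Injective R I ∧
    Function.Exact f f ∧
    Nonempty (M ≃ₗ[R] LinearMap.ker f) ∧
    (∀ (E : Type u) (_ : AddCommGroup E) (_ : Module R E), Module.Injective R E →
      Function.Exact (fun g : E →ₗ[R] I => f.comp g) (fun g : E →ₗ[R] I => f.comp g))

/-- `M` admits a resolution `0 → G_n → ⋯ → G_0 → M → 0` by modules satisfying `𝒢`
(formalized as an `ℕ`-indexed resolution vanishing in degrees `> n`). -/
def HasLeftResolutionLE
    (𝒢 : ∀ (N : Type u) [AddCommGroup N] [Module R N], Prop)
    (M : Type u) [AddCommGroup M] [Module R M] (n : ℕ) : Prop :=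
  ∃ (G : ℕ → Type u) (_ : ∀ i, AddCommGroup (G i)) (_ : ∀ i, Module R (G i))
    (d : ∀ i, G (i + 1) →ₗ[R] G i) (π : G 0 →ₗ[R] M),
      (∀ i, 𝒢 (G i)) ∧
      (∀ i, n < i → Subsingleton (G i)) ∧
      Function.Surjective π ∧ Function.Exact (d 0) π ∧
      (∀ i, Function.Exact (d (i + 1)) (d i))

/-- `M` admits a coresolution `0 → M → G^0 → ⋯ → G^n → 0` by modules satisfying `𝒢`. -/
def HasRightResolutionLE
    (𝒢 : ∀ (N : Type u) [AddCommGroup N] [Module R N], Prop)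
    (M : Type u) [AddCommGroup M] [Module R M] (n : ℕ) : Prop :=
  ∃ (G : ℕ → Type u) (_ : ∀ i, AddCommGroup (G i)) (_ : ∀ i, Module R (G i))
    (d : ∀ i, G i →ₗ[R] G (i + 1)) (ι : M →ₗ[R] G 0),
      (∀ i, 𝒢 (G i)) ∧
      (∀ i, n < i → Subsingleton (G i)) ∧
      Function.Injective ι ∧ Function.Exact ι (d 0) ∧
      (∀ i, Function.Exact (d i) (d (i + 1)))

variable (M : Type u) [AddCommGroup M] [Module R M]

/-- Projective dimension, valued in `ℕ∞`. -/
noncomputable def pDim : ℕ∞ :=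
  sInf ((↑) '' {n : ℕ | HasLeftResolutionLE R (fun N _ _ => Module.Projective R N) M n})

/-- Injective dimension, valued in `ℕ∞`. -/
noncomputable def iDim : ℕ∞ :=
  sInf ((↑) '' {n : ℕ | HasRightResolutionLE R (fun N _ _ => Module.Injective R N) M n})

/-- Gorenstein projective dimension, valued in `ℕ∞`. -/
noncomputable def gpDim : ℕ∞ :=
  sInf ((↑) '' {n : ℕ | HasLeftResolutionLE R (fun N _ _ => GorensteinProjective R N) M n})

/-- Gorenstein injective dimension, valued in `ℕ∞`. -/
noncomputable def giDim : ℕ∞ :=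
  sInf ((↑) '' {n : ℕ | HasRightResolutionLE R (fun N _ _ => GorensteinInjective R N) M n})

/-- The left global dimension of `R`. -/
noncomputable def gldim : ℕ∞ :=
  sSup {d : ℕ∞ | ∃ (M : Type u) (_ : AddCommGroup M) (_ : Module R M), d = pDim R M}

/-- The left finitistic projective dimension of `R`. -/
noncomputable def FPD : ℕ∞ :=
  sSup {d : ℕ∞ | ∃ (M : Type u) (_ : AddCommGroup M) (_ : Module R M),
    pDim R M ≠ ⊤ ∧ d = pDim R M}

/-- The left Gorenstein global dimension of `R`: `sup { Gpd_R(M) }`. -/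
noncomputable def GPgldim : ℕ∞ :=
  sSup {d : ℕ∞ | ∃ (M : Type u) (_ : AddCommGroup M) (_ : Module R M), d = gpDim R M}

/-- `sup { Gid_R(M) }` over all left `R`-modules `M`. -/
noncomputable def GIgldim : ℕ∞ :=
  sSup {d : ℕ∞ | ∃ (M : Type u) (_ : AddCommGroup M) (_ : Module R M), d = giDim R M}

end Defs

namespace QF

theorem exists_factor {R : Type u} [Ring R] {A B Q : Type u} [AddCommGroup A] [Module R A]
    [AddCommGroup B] [Module R B] [AddCommGroup Q] [Module R Q] (hQ : Module.Injective R Q)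
    (d : A →ₗ[R] B) (g : A →ₗ[R] Q) (h : ∀ x, d x = 0 → g x = 0) :
    ∃ k : B →ₗ[R] Q, ∀ x, k (d x) = g x := by
  have hle : LinearMap.ker d ≤ LinearMap.ker g := fun x hx => h x hx
  obtain ⟨k, hk⟩ := hQ.out ((LinearMap.ker d).liftQ d le_rfl)
    (by rw [← LinearMap.ker_eq_bot]; exact Submodule.ker_liftQ_eq_bot _ _ _ le_rfl)
    ((LinearMap.ker d).liftQ g hle)
  exact ⟨k, fun x => by simpa using hk (Submodule.Quotient.mk x)⟩

theorem ext_fin {R : Type u} [Ring R] (hR : Module.Injective R R) {ι : Type u} [Fintype ι]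
    (x : ι → R) (y : R) (h : ∀ r, (∀ i, r * x i = 0) → r * y = 0) :
    ∃ c : ι → R, y = ∑ i, x i * c i := by
  classical
  obtain ⟨k, hk⟩ := exists_factor hR (LinearMap.toSpanSingleton R (ι → R) x)
    (LinearMap.toSpanSingleton R R y) (fun r hr => by
      simpa using h r (fun i => by simpa using congrFun hr i))
  refine ⟨fun i => k (Pi.single i 1), ?_⟩
  have h1 := hk 1
  simp only [LinearMap.toSpanSingleton_apply, one_smul] at h1
  rw [← h1]
  conv_lhs => rw [pi_eq_sum_univ' x]
  simp [map_sum]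

theorem ext_one {R : Type u} [Ring R] (hR : Module.Injective R R)
    (x y : R) (h : ∀ r, r * x = 0 → r * y = 0) : ∃ c : R, y = x * c := by
  obtain ⟨c, hc⟩ := ext_fin hR (ι := PUnit) (fun _ => x) y (fun r hr => h r (hr ⟨⟩))
  exact ⟨c ⟨⟩, by simpa using hc⟩

/-- The left annihilator of `a` is an essential left ideal. -/
def Ess {R : Type u} [Ring R] (a : R) : Prop := ∀ b : R, b ≠ 0 → ∃ r, r * b ≠ 0 ∧ r * b * a = 0

theorem Ess.mul_right {R : Type u} [Ring R] {a : R} (h : Ess a) (c : R) : Ess (a * c) := by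
  intro b hb
  obtain ⟨r, h1, h2⟩ := h b hb
  exact ⟨r, h1, by rw [← mul_assoc, h2, zero_mul]⟩

theorem Ess.mul_left {R : Type u} [Ring R] {a : R} (h : Ess a) (y : R) : Ess (y * a) := by
  intro b hb
  by_cases hy : b * y = 0
  · exact ⟨1, by simpa using hb, by rw [← mul_assoc, one_mul, hy, zero_mul]⟩
  · obtain ⟨r, h1, h2⟩ := h _ hy
    refine ⟨r, fun h0 => h1 (by rw [← mul_assoc, h0, zero_mul]), ?_⟩
    simpa [mul_assoc] using h2

theorem Ess.neg {R : Type u} [Ring R] {a : R} (h : Ess a) : Ess (-a) := by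
  simpa using h.mul_right (-1)

theorem Ess.right_inv {R : Type u} [Ring R] (hR : Module.Injective R R) {a : R} (h : Ess a) :
    ∃ c, (1 + a) * c = 1 := by
  obtain ⟨c, hc⟩ := ext_one hR (1 + a) 1 (fun b hb => by
    by_contra hne
    rw [mul_one] at hne
    obtain ⟨r, h1, h2⟩ := h b hne
    apply h1
    have : r * (b * (1 + a)) = 0 := by rw [hb, mul_zero]
    rw [mul_add, mul_one, mul_add, ← mul_assoc, h2, add_zero] at this
    exact this)
  exact ⟨c, hc.symm⟩

theorem Ess.left_inv {R : Type u} [Ring R] (hR : Module.Injective R R) {a : R} (h : Ess a) :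
    ∃ c, c * (1 + a) = 1 := by
  obtain ⟨c, hc⟩ := h.right_inv hR
  have hc' : c = 1 + -(a * c) := by
    have : c + a * c = 1 := by rw [← hc]; noncomm_ring
    rw [← this]; abel
  obtain ⟨e, he⟩ := (h.mul_right c).neg.right_inv hR
  rw [← hc'] at he
  have : 1 + a = e := left_inv_eq_right_inv hc he
  exact ⟨c, by rw [this, he]⟩

theorem Ess.mem_jacobson {R : Type u} [Ring R] (hR : Module.Injective R R) {a : R} (h : Ess a) :
    a ∈ Ring.jacobson R := by
  rw [← Ideal.jacobson_bot, Ideal.mem_jacobson_iff]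
  intro y
  obtain ⟨z, hz⟩ := (h.mul_left y).left_inv hR
  refine ⟨z, ?_⟩
  rw [Ideal.mem_bot, ← hz]
  noncomm_ring

theorem ess_of_mem_jacobson {R : Type u} [Ring R] (hR : Module.Injective R R) {a : R}
    (h : a ∈ Ring.jacobson R) : Ess a := by
  intro b hb
  by_contra hcon
  push Not at hcon
  obtain ⟨c, hc⟩ := ext_one hR (b * a) b (fun r hr => by
    by_contra hne
    exact hcon r hne (by rw [mul_assoc, hr]))
  have hac : a * c ∈ Ring.jacobson R := Ideal.mul_mem_right _ _ h
  rw [← Ideal.jacobson_bot, Ideal.mem_jacobson_iff] at hac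
  obtain ⟨z, hz⟩ := hac (-1)
  rw [Ideal.mem_bot] at hz
  -- `z` is a left inverse of `1 - a c`; get a right inverse through `z`
  have hz1 : z * (1 - a * c) = 1 := by
    rw [← sub_eq_zero, ← hz]; noncomm_ring
  have hac : a * c ∈ Ring.jacobson R := Ideal.mul_mem_right _ _ h
  have hzac : z * (a * c) ∈ Ring.jacobson R := Ideal.mul_mem_left _ _ hac
  rw [← Ideal.jacobson_bot, Ideal.mem_jacobson_iff] at hzac
  obtain ⟨w, hw⟩ := hzac 1
  rw [Ideal.mem_bot] at hw
  have hzz : z = 1 + z * (a * c) := by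
    rw [← hz1]; noncomm_ring
  have hw1 : w * z = 1 := by
    rw [← sub_eq_zero, ← hw, hzz]
    rw [← hzz]; conv_lhs => rw [hzz]
    noncomm_ring
  have hwu : w = 1 - a * c := left_inv_eq_right_inv hw1 hz1
  apply hb
  have h0 : b * (1 - a * c) = 0 := by rw [mul_sub, mul_one, ← mul_assoc, ← hc, sub_self]
  calc b = b * (1 - a * c) * z := by rw [← hwu, mul_assoc, hw1, mul_one]
    _ = 0 := by rw [h0, zero_mul]

/-- left annihilator of a set -/
def lann {R : Type u} [Ring R] (s : Set R) : Ideal R where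
  carrier := {r | ∀ x ∈ s, r * x = 0}
  add_mem' := fun {a b} ha hb x hx => by rw [add_mul, ha x hx, hb x hx, add_zero]
  zero_mem' := fun x _ => zero_mul x
  smul_mem' := fun c r hr x hx => by rw [smul_eq_mul, mul_assoc, hr x hx, mul_zero]

theorem mem_lann {R : Type u} [Ring R] {s : Set R} {r : R} :
    r ∈ lann s ↔ ∀ x ∈ s, r * x = 0 := Iff.rfl

theorem regular_mod {R : Type u} [Ring R] [IsNoetherianRing R] (hR : Module.Injective R R)
    (a : R) : ∃ b, a * b * a - a ∈ Ring.jacobson R := by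
  obtain ⟨K, hK, hmax⟩ := set_has_maximal_iff_noetherian.mpr (inferInstance : IsNoetherian R R)
    {K : Ideal R | ∀ k ∈ K, k * a = 0 → k = 0} ⟨⊥, fun k hk _ => by simpa using hk⟩
  obtain ⟨f, hf⟩ := hR.out ((LinearMap.toSpanSingleton R R a).comp K.subtype) (by
    rw [← LinearMap.ker_eq_bot, LinearMap.ker_eq_bot']
    intro k hk
    exact Subtype.ext (hK k k.2 (by simpa using hk))) K.subtype
  have hb : ∀ k ∈ K, k * a * f 1 = k := by
    intro k hk
    have := hf ⟨k, hk⟩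
    simp only [LinearMap.comp_apply, Submodule.subtype_apply,
      LinearMap.toSpanSingleton_apply, smul_eq_mul] at this
    conv_rhs => rw [← this]
    rw [← smul_eq_mul, ← map_smul, smul_eq_mul, mul_one]
  refine ⟨f 1, Ess.mem_jacobson hR ?_⟩
  have hk0 : ∀ k ∈ K, k * (a * f 1 * a - a) = 0 := by
    intro k hk
    rw [mul_sub, ← mul_assoc, ← mul_assoc, hb k hk, sub_self]
  intro t ht
  by_cases htK : t ∈ K
  · exact ⟨1, by simpa using ht, by rw [one_mul, hk0 t htK]⟩
  · have hlt : K < K ⊔ Submodule.span R {t} := by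
      refine lt_of_le_of_ne le_sup_left fun h => htK ?_
      rw [h]
      exact Submodule.mem_sup_right (Submodule.mem_span_singleton_self t)
    have hn : ¬ (K ⊔ Submodule.span R {t}) ∈ {K : Ideal R | ∀ k ∈ K, k * a = 0 → k = 0} :=
      fun h => hmax _ h hlt
    simp only [Set.mem_ofPred_eq, not_forall] at hn
    obtain ⟨x, hx, hxa, hx0⟩ := hn
    obtain ⟨k, hk, s, hs, rfl⟩ := Submodule.mem_sup.mp hx
    obtain ⟨r, rfl⟩ := Submodule.mem_span_singleton.mp hs
    rw [smul_eq_mul] at *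
    refine ⟨r, fun h0 => hx0 ?_, ?_⟩
    · rw [h0, add_zero] at hxa ⊢
      exact hK k hk hxa
    · have : r * t = (k + r * t) - k := by abel
      rw [this, sub_mul, hk0 k hk, sub_zero, mul_sub, ← mul_assoc, ← mul_assoc, hxa]
      simp

theorem semisimple_of_regular {S : Type u} [Ring S] [IsNoetherianRing S]
    (h : ∀ y : S, ∃ b, y * b * y = y) : IsSemisimpleRing S := by
  refine (isSemisimpleModule_iff S S).mpr ⟨fun K => ?_⟩
  obtain ⟨I, ⟨e, heK, he, rfl⟩, hmax⟩ :=
    set_has_maximal_iff_noetherian.mpr (inferInstance : IsNoetherian S S)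
    {I : Ideal S | ∃ e ∈ K, e * e = e ∧ I = Submodule.span S {e}}
    ⟨Submodule.span S {0}, 0, K.zero_mem, by simp, rfl⟩
  have key : ∀ x ∈ K, x * e = x := by
    intro x hx
    by_contra hne
    obtain ⟨b, hb⟩ := h (x - x * e)
    set y := x - x * e with hy
    have hye : y * e = 0 := by rw [hy, sub_mul, mul_assoc, he, sub_self]
    have hyK : y ∈ K := K.sub_mem hx (K.smul_mem x heK)
    have hy0 : y ≠ 0 := fun h0 => hne (sub_eq_zero.mp h0).symm
    set f := b * y with hf
    have hff : f * f = f := by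
      rw [hf, mul_assoc, ← mul_assoc y, hb]
    have hfe : f * e = 0 := by rw [hf, mul_assoc, hye, mul_zero]
    have hfK : f ∈ K := K.smul_mem b hyK
    have hgK : e + f - e * f ∈ K := K.sub_mem (K.add_mem heK hfK) (K.smul_mem e hfK)
    clear_value f y
    have heg : e * (e + f - e * f) = e := by
      rw [mul_sub, mul_add, ← mul_assoc e e f, he]; abel
    have hfg : f * (e + f - e * f) = f := by
      rw [mul_sub, mul_add, ← mul_assoc f e f, hfe, hff]; simp
    have hgg : (e + f - e * f) * (e + f - e * f) = e + f - e * f := by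
      rw [sub_mul, add_mul, heg, hfg, mul_assoc, hfg]
    refine hmax _ ⟨_, hgK, hgg, rfl⟩ (lt_of_le_of_ne ?_ ?_)
    · rw [Submodule.span_singleton_le_iff_mem, Submodule.mem_span_singleton]
      exact ⟨e, heg⟩
    · intro heq
      have : f ∈ Submodule.span S {e} := by
        rw [heq, Submodule.mem_span_singleton]
        exact ⟨f, hfg⟩
      obtain ⟨s, hs⟩ := Submodule.mem_span_singleton.mp this
      rw [smul_eq_mul] at hs
      have hf0 : f = 0 := by
        rw [← hfe, ← hs, mul_assoc, he]
      apply hy0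
      rw [← hb, mul_assoc, ← hf, hf0, mul_zero]
  refine ⟨Submodule.span S {1 - e}, ?_, ?_⟩
  · rw [Submodule.disjoint_def]
    intro x hx hx'
    obtain ⟨s, rfl⟩ := Submodule.mem_span_singleton.mp hx'
    rw [← key _ hx, smul_eq_mul, mul_assoc, sub_mul, he, one_mul, sub_self, mul_zero]
  · rw [codisjoint_iff, Ideal.eq_top_iff_one]
    have : (1 : S) = e + (1 - e) := by abel
    have h2 : e + (1 - e) ∈ K ⊔ Submodule.span S {1 - e} :=
      Submodule.add_mem_sup heK (Submodule.mem_span_singleton_self _)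
    rwa [← this] at h2

theorem jacobson_nilpotent {R : Type u} [Ring R] [IsNoetherianRing R]
    (hR : Module.Injective R R) : IsNilpotent (Ring.jacobson R) := by
  set J := Ring.jacobson R with hJ
  have hle : ∀ n, J ^ (n + 1) ≤ J ^ n := fun n => by
    rw [Ideal.IsTwoSided.pow_succ]; exact Ideal.mul_le.mpr fun r _ s hs => Ideal.mul_mem_left _ r hs
  have hanti : Antitone fun n => J ^ n := antitone_nat_of_succ_le hle
  obtain ⟨n, hn⟩ := monotone_stabilizes_iff_noetherian.mpr (inferInstance : IsNoetherian R R)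
    ⟨fun n => lann ((J ^ n : Ideal R) : Set R), fun m k hmk r hr x hx => hr x (hanti hmk hx)⟩
  refine ⟨n, ?_⟩
  by_contra hne
  obtain ⟨I, ⟨a, ha, rfl⟩, hmax⟩ :=
    set_has_maximal_iff_noetherian.mpr (inferInstance : IsNoetherian R R)
    {I : Ideal R | ∃ a, a ∉ lann ((J ^ n : Ideal R) : Set R) ∧ I = lann {a}}
    ⟨lann {1}, 1, fun h => hne (by
      rw [Ideal.zero_eq_bot, eq_bot_iff]
      intro x hx
      simpa using h x hx), rfl⟩
  apply ha
  have h1 := hn (n + 1) (Nat.le_succ n)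
  change lann ((J ^ n : Ideal R) : Set R) = lann ((J ^ (n + 1) : Ideal R) : Set R) at h1
  rw [h1]
  have hab : ∀ b ∈ J, a * b ∈ lann ((J ^ n : Ideal R) : Set R) := by
    intro b hb
    by_contra hcon
    have ha0 : a ≠ 0 := fun h0 => ha (h0 ▸ Submodule.zero_mem _)
    obtain ⟨r, hr1, hr2⟩ := ess_of_mem_jacobson hR hb a ha0
    refine hmax _ ⟨_, hcon, rfl⟩ (lt_of_le_of_ne ?_ ?_)
    · intro s hs x hx
      rw [Set.mem_singleton_iff.mp hx, ← mul_assoc, hs a rfl, zero_mul]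
    · intro heq
      have : r ∈ lann {a * b} := by
        intro x hx
        rw [Set.mem_singleton_iff.mp hx, ← mul_assoc, hr2]
      rw [← heq] at this
      exact hr1 (this a rfl)
  intro x hx
  rw [SetLike.mem_coe, Ideal.IsTwoSided.pow_succ] at hx
  refine Submodule.mul_induction_on' (C := fun x _ => a * x = 0) ?_ ?_ hx
  · intro b hb z hz
    rw [← mul_assoc]
    exact hab b hb z hz
  · intro x _ y _ hx hy
    rw [mul_add, hx, hy, add_zero]

theorem artinian {R : Type u} [Ring R] [IsNoetherianRing R]
    (hR : Module.Injective R R) : IsArtinianRing R := by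
  have hN : IsNoetherianRing (R ⧸ Ring.jacobson R) :=
    isNoetherianRing_of_surjective R _ (Ideal.Quotient.mk (Ring.jacobson R))
      Ideal.Quotient.mk_surjective
  have hs : IsSemisimpleRing (R ⧸ Ring.jacobson R) := semisimple_of_regular fun y => by
    obtain ⟨a, rfl⟩ := Ideal.Quotient.mk_surjective y
    obtain ⟨b, hb⟩ := regular_mod hR a
    refine ⟨Ideal.Quotient.mk _ b, ?_⟩
    rw [← map_mul, ← map_mul]
    exact Ideal.Quotient.eq.mpr hb
  have : IsSemiprimaryRing R := ⟨hs, jacobson_nilpotent hR⟩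
  exact IsSemiprimaryRing.isNoetherian_iff_isArtinian.mp inferInstance

/-- Every left module embeds in a free left module. -/
def EmbFree (R : Type u) [Ring R] : Prop :=
  ∀ (M : Type u) [AddCommGroup M] [Module R M],
    ∃ (X : Type u) (f : M →ₗ[R] (X →₀ R)), Function.Injective f

/-- Every projective left module is injective. -/
def ProjInj (R : Type u) [Ring R] : Prop :=
  ∀ (Q : Type u) [AddCommGroup Q] [Module R Q], Module.Projective R Q → Module.Injective R Q

theorem noetherian_of {R : Type u} [Ring R] (ha : ProjInj R) (hb : EmbFree R) :
    IsNoetherianRing R := by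
  classical
  refine monotone_stabilizes_iff_noetherian.mp fun f => ?_
  obtain ⟨X, F, hF⟩ := hb (∀ n, R ⧸ f n)
  let j : ∀ n, R →ₗ[R] (X →₀ R) := fun n =>
    F ∘ₗ LinearMap.single R (fun n => R ⧸ f n) n ∘ₗ (f n).mkQ
  have hj : ∀ n a, j n a = 0 ↔ a ∈ f n := by
    intro n a
    change F (Pi.single n (Submodule.Quotient.mk a)) = 0 ↔ _
    rw [map_eq_zero_iff F hF, Pi.single_eq_zero_iff, Submodule.Quotient.mk_eq_zero]
  have hmem : ∀ a : R, a ∈ (⨆ n, f n : Ideal R) ↔ ∃ n, a ∈ f n := fun a =>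
    Submodule.mem_iSup_of_directed _ f.monotone.directed_le
  have hfin : ∀ a : (⨆ n, f n : Ideal R), (Function.support fun n => j n a.1).Finite := by
    rintro ⟨a, ha⟩
    obtain ⟨n, hn⟩ := (hmem a).mp ha
    refine (Set.finite_lt_nat n).subset fun k hk => ?_
    by_contra hkn
    exact hk ((hj k a).mpr (f.monotone (not_lt.mp hkn) hn))
  let g : (⨆ n, f n : Ideal R) →ₗ[R] (ℕ →₀ (X →₀ R)) :=
    { toFun := fun a => Finsupp.ofSupportFinite _ (hfin a)
      map_add' := fun a b => by
        ext n : 1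
        simp [Finsupp.ofSupportFinite_coe]
      map_smul' := fun c a => by
        ext n : 1
        exact map_smul (j n) c a.1 }
  obtain ⟨h, hh⟩ := Module.Baer.of_injective
    (ha (ℕ →₀ (X →₀ R)) inferInstance) _ g
  obtain ⟨n, hn⟩ : ∃ n, ∀ k, n ≤ k → h 1 k = 0 := by
    obtain ⟨n, hn⟩ := (h 1).support.exists_nat_subset_range
    refine ⟨n, fun k hk => ?_⟩
    by_contra hne
    have := hn (Finsupp.mem_support_iff.mpr hne)
    simp at this
    omega
  refine ⟨n, fun m hm => le_antisymm (f.monotone hm) fun a ha => ?_⟩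
  have hmem' : a ∈ (⨆ n, f n : Ideal R) := (hmem a).mpr ⟨m, ha⟩
  have h1 := hh a hmem'
  have h2 : j n a = h a n := by rw [h1]; rfl
  rw [← hj, h2, ← mul_one a, ← smul_eq_mul, map_smul, Finsupp.smul_apply, hn n le_rfl, smul_zero]

theorem right_noetherian_of {R : Type u} [Ring R] [IsArtinianRing R]
    (hR : Module.Injective R R) : IsNoetherianRing Rᵐᵒᵖ := by
  classical
  refine ⟨fun K => ?_⟩
  obtain ⟨I, ⟨F, hFK, rfl⟩, hmin⟩ := IsArtinian.set_has_minimal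
    {I : Ideal R | ∃ F : Finset R, (∀ x ∈ F, MulOpposite.op x ∈ K) ∧ I = lann (F : Set R)}
    ⟨_, ∅, by simp, rfl⟩
  refine ⟨F.image MulOpposite.op, le_antisymm (Submodule.span_le.mpr ?_) fun x hx => ?_⟩
  · intro y hy
    obtain ⟨x, hx, rfl⟩ := Finset.mem_image.mp (Finset.mem_coe.mp hy)
    exact hFK x hx
  · have h1 : ∀ r, (∀ i : F, r * i.1 = 0) → r * x.unop = 0 := by
      intro r hr
      by_contra hne
      refine hmin (lann ((insert x.unop F : Finset R) : Set R)) ⟨_, ?_, rfl⟩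
        (lt_of_le_of_ne ?_ ?_)
      · intro y hy
        rcases Finset.mem_insert.mp hy with rfl | hy
        · exact hx
        · exact hFK y hy
      · intro s hs y hy
        exact hs y (Finset.mem_coe.mpr (Finset.mem_insert_of_mem hy))
      · intro heq
        have : r ∈ lann (F : Set R) := fun y hy => hr ⟨y, hy⟩
        rw [← heq] at this
        exact hne (this _ (Finset.mem_coe.mpr (Finset.mem_insert_self _ _)))
    obtain ⟨c, hc⟩ := ext_fin hR (fun i : F => i.1) x.unop h1
    have : x = ∑ i : F, MulOpposite.op (c i) • MulOpposite.op i.1 := by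
      apply MulOpposite.unop_injective
      rw [hc, Finset.unop_sum]
      rfl
    rw [this]
    refine Submodule.sum_mem _ fun i _ => Submodule.smul_mem _ _ (Submodule.subset_span ?_)
    exact Finset.mem_coe.mpr (Finset.mem_image_of_mem _ i.2)

theorem right_injective_of {R : Type u} [Ring R] [hN : IsNoetherianRing Rᵐᵒᵖ]
    (hb : EmbFree R) : Module.Injective Rᵐᵒᵖ Rᵐᵒᵖ := by
  classical
  refine Module.Baer.injective fun K g => ?_
  obtain ⟨F, hF⟩ := hN.noetherian K
  have hFK : ∀ i : F, i.1 ∈ K := fun i => by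
    rw [← hF]; exact Submodule.subset_span i.2
  let x : F → R := fun i => i.1.unop
  let y : F → R := fun i => (g ⟨i.1, hFK i⟩).unop
  have hy : y ∈ Submodule.span R {x} := by
    obtain ⟨X, f, hf⟩ := hb ((F → R) ⧸ Submodule.span R {x})
    rw [← Submodule.Quotient.mk_eq_zero, ← map_eq_zero_iff f hf]
    ext t
    let φ : (F → R) →ₗ[R] R := Finsupp.lapply t ∘ₗ f ∘ₗ Submodule.mkQ _
    have hφ : ∀ z, φ z = ∑ i, z i * φ (Pi.single i 1) := by
      intro z
      conv_lhs => rw [pi_eq_sum_univ' z]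
      simp only [map_sum, map_smul, smul_eq_mul]
    have hx0 : φ x = 0 := by
      have : (Submodule.span R {x}).mkQ x = 0 :=
        (Submodule.Quotient.mk_eq_zero _).mpr (Submodule.mem_span_singleton_self x)
      simp only [φ, LinearMap.comp_apply, this, map_zero]
    change φ y = 0
    rw [hφ] at hx0 ⊢
    have h1 : ∑ i : F, MulOpposite.op (φ (Pi.single i 1)) • (⟨i.1, hFK i⟩ : K) = 0 := by
      apply Subtype.ext
      apply MulOpposite.unop_injective
      simp only [Submodule.coe_sum, Finset.unop_sum]
      exact hx0
    have h2 := congrArg (fun z => (g z).unop) h1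
    simp only [map_sum, map_smul, Finset.unop_sum, map_zero, MulOpposite.unop_zero] at h2
    exact h2
  obtain ⟨c, hc⟩ := Submodule.mem_span_singleton.mp hy
  refine ⟨LinearMap.toSpanSingleton _ _ (MulOpposite.op c), ?_⟩
  have hle : K ≤ (LinearMap.eqLocus ((LinearMap.toSpanSingleton _ _ (MulOpposite.op c)).comp
      K.subtype) g).map K.subtype := by
    conv_lhs => rw [← hF]
    rw [Submodule.span_le]
    intro i hi
    refine ⟨⟨i, hFK ⟨i, hi⟩⟩, ?_, rfl⟩
    change i * MulOpposite.op c = g _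
    apply MulOpposite.unop_injective
    exact congrFun hc ⟨i, hi⟩
  intro z hz
  obtain ⟨w, hw, rfl⟩ := hle hz
  exact hw

theorem projInj_of {R : Type u} [Ring R] [hN : IsNoetherianRing R]
    (hR : Module.Injective R R) : ProjInj R := by
  classical
  have hfree : ∀ X : Type u, Module.Baer R (X →₀ R) := by
    intro X I g
    obtain ⟨F, hF⟩ := (Submodule.fg_top I).mpr (hN.noetherian I)
    let T : Finset X := F.biUnion fun i => (g i).support
    have hT : ∀ i, g i ∈ Finsupp.supported R R (T : Set X) := by
      intro i
      have : (⊤ : Submodule R I) ≤ (Finsupp.supported R R (T : Set X)).comap g := by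
        rw [← hF, Submodule.span_le]
        intro i hi
        rw [SetLike.mem_coe, Submodule.mem_comap, Finsupp.mem_supported]
        intro x hx
        exact Finset.mem_coe.mpr (Finset.mem_biUnion.mpr ⟨i, hi, hx⟩)
      exact this Submodule.mem_top
    have hB := Module.Baer.of_injective hR
    choose h hh using fun x : X => hB I (Finsupp.lapply x ∘ₗ g)
    refine ⟨∑ x ∈ T, Finsupp.lsingle x ∘ₗ h x, fun a ha => ?_⟩
    ext x
    simp only [LinearMap.sum_apply, LinearMap.comp_apply, Finsupp.lsingle_apply,
      Finsupp.finsetSum_apply, Finsupp.single_apply, Finset.sum_ite_eq']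
    split_ifs with hx
    · exact hh x a ha
    · symm
      by_contra hne
      exact hx (Finset.mem_coe.mp (hT ⟨a, ha⟩ (Finsupp.mem_support_iff.mpr hne)))
  intro Q _ _ hQ
  obtain ⟨s, hs⟩ := hQ.out
  refine Module.Baer.injective fun I g => ?_
  obtain ⟨h, hh⟩ := hfree Q I (s ∘ₗ g)
  refine ⟨Finsupp.linearCombination R id ∘ₗ h, fun x hx => ?_⟩
  rw [LinearMap.comp_apply, hh x hx]
  exact hs _

theorem simple_emb {R : Type u} [Ring R] [hN : IsNoetherianRing R]
    (hR : Module.Injective Rᵐᵒᵖ Rᵐᵒᵖ) (S : Type u) [AddCommGroup S] [Module R S]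
    [hS : IsSimpleModule R S] : ∃ f : S →ₗ[R] R, Function.Injective f := by
  classical
  obtain ⟨I, hI, ⟨e⟩⟩ := isSimpleModule_iff_quot_maximal.mp hS
  obtain ⟨F, hF⟩ := hN.noetherian I
  obtain ⟨b, hb, hb0⟩ : ∃ b : R, (∀ x ∈ F, x * b = 0) ∧ b ≠ 0 := by
    by_contra hcon
    push Not at hcon
    obtain ⟨c, hc⟩ := ext_fin hR (fun i : F => MulOpposite.op i.1) 1 (fun r hr => by
      rw [mul_one]
      apply MulOpposite.unop_injective
      exact hcon r.unop fun x hx => congrArg MulOpposite.unop (hr ⟨x, hx⟩))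
    apply hI.ne_top
    rw [Ideal.eq_top_iff_one]
    have : (1 : R) = ∑ i : F, (c i).unop * i.1 := by
      have := congrArg MulOpposite.unop hc
      rw [Finset.unop_sum] at this
      exact this
    rw [this, ← hF]
    exact Submodule.sum_mem _ fun i _ => Submodule.smul_mem _ _ (Submodule.subset_span i.2)
  have hle : I ≤ LinearMap.ker (LinearMap.toSpanSingleton R R b) := by
    rw [← hF, Submodule.span_le]
    intro x hx
    simpa using hb x hx
  let f := I.liftQ _ hle ∘ₗ e.toLinearMap
  refine ⟨f, (LinearMap.injective_or_eq_zero f).resolve_right fun h0 => hb0 ?_⟩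
  have := LinearMap.congr_fun h0 (e.symm (Submodule.Quotient.mk 1))
  simpa [f] using this

theorem embFree_of {R : Type u} [Ring R] [hN : IsNoetherianRing R]
    (hL : Module.Injective R R) (hR : Module.Injective Rᵐᵒᵖ Rᵐᵒᵖ) : EmbFree R := by
  classical
  have := artinian hL
  have hPI := projInj_of hL
  intro M _ _
  let N : Submodule R M := ⨆ m ∈ {m : Submodule R M | IsSimpleModule R m}, m
  have hNs : IsSemisimpleModule R N :=
    isSemisimpleModule_biSup_of_isSemisimpleModule_submodule (fun m hm => by
      have : IsSimpleModule R m := hm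
      infer_instance)
  obtain ⟨s, e, -, hs⟩ := IsSemisimpleModule.exists_linearEquiv_dfinsupp R N
  choose f hf using fun m : s => simple_emb hR m.1
  let g : N →ₗ[R] (s →₀ R) := (finsuppLequivDFinsupp R).symm.toLinearMap ∘ₗ
    DFinsupp.mapRange.linearMap f ∘ₗ e.toLinearMap
  have hg : Function.Injective g := by
    have h1 : Function.Injective (DFinsupp.mapRange.linearMap f) :=
      (DFinsupp.mapRange_injective _ (fun m => map_zero (f m))).mpr hf
    exact (finsuppLequivDFinsupp (ι := s) (M := R) R).symm.injective.comp (h1.comp e.injective)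
  obtain ⟨h, hh⟩ := (hPI (s →₀ R) inferInstance).out N.subtype N.injective_subtype g
  refine ⟨s, h, ?_⟩
  rw [← LinearMap.ker_eq_bot, LinearMap.ker_eq_bot']
  intro m hm
  by_contra hm0
  let C := Submodule.span R {m}
  have hC : C ≤ LinearMap.ker h := by
    rw [Submodule.span_singleton_le_iff_mem]; exact hm
  have hCn : Nontrivial C := ⟨⟨⟨m, Submodule.mem_span_singleton_self m⟩, 0, fun h0 =>
    hm0 (congrArg Subtype.val h0)⟩⟩
  have hCa : IsArtinian R C := inferInstance
  have hat : IsAtomic (Submodule R C) := inferInstance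
  obtain ⟨A, hA⟩ := IsAtomic.exists_atom (Submodule R C)
  have hAs : IsSimpleModule R A := isSimpleModule_iff_isAtom.mpr hA
  have hBs : IsSimpleModule R (A.map C.subtype) :=
    .congr (Submodule.equivMapOfInjective C.subtype C.injective_subtype A).symm
  have hBN : A.map C.subtype ≤ N :=
    le_iSup₂_of_le (A.map C.subtype) hBs le_rfl
  obtain ⟨a, haA, ha0⟩ := (Submodule.ne_bot_iff _).mp hA.1
  have haN : (a : M) ∈ N := hBN ⟨a, haA, rfl⟩
  have h1 := hh ⟨a, haN⟩
  have h2 : h a = 0 := hC a.2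
  rw [Submodule.subtype_apply, h2] at h1
  have h3 := (map_eq_zero_iff g hg).mp h1.symm
  exact ha0 (Subtype.ext (congrArg (fun z : N => (z : M)) h3))

theorem exists_int_seq {α : Type*} (r : α → α → Prop) (h1 : ∀ a, ∃ b, r a b)
    (h2 : ∀ b, ∃ a, r a b) (a : α) : ∃ Z : ℤ → α, Z 0 = a ∧ ∀ i, r (Z i) (Z (i + 1)) := by
  choose f hf using h1
  choose g hg using h2
  refine ⟨fun i => match i with
    | Int.ofNat n => f^[n] a
    | Int.negSucc n => g^[n + 1] a, rfl, fun i => ?_⟩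
  match i with
  | Int.ofNat n =>
    change r (f^[n] a) (f^[n + 1] a)
    rw [Function.iterate_succ_apply']
    exact hf _
  | Int.negSucc 0 =>
    exact hg a
  | Int.negSucc (n + 1) =>
    have : Int.negSucc (n + 1) + 1 = Int.negSucc n := by omega
    rw [this]
    change r (g^[n + 1 + 1] a) (g^[n + 1] a)
    rw [Function.iterate_succ_apply' g (n + 1)]
    exact hg _

/-- There is a short exact sequence `0 → A → P → B → 0` with `P` projective. -/
def SesRel (R : Type u) [Ring R] (A B : ModuleCat.{u} R) : Prop :=
  ∃ (P : ModuleCat.{u} R) (ι : A →ₗ[R] P) (π : P →ₗ[R] B), Module.Projective R P ∧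
    Function.Injective ι ∧ Function.Exact ι π ∧ Function.Surjective π

theorem gp_of {R : Type u} [Ring R] (ha : ProjInj R) (hb : EmbFree R)
    (M : Type u) [AddCommGroup M] [Module R M] : GorensteinProjective R M := by
  obtain ⟨Z, hZ0, hZ⟩ := exists_int_seq (SesRel R) (fun A => by
      obtain ⟨X, f, hf⟩ := hb A
      exact ⟨ModuleCat.of R ((X →₀ R) ⧸ LinearMap.range f), ModuleCat.of R (X →₀ R), f,
        Submodule.mkQ _, inferInstanceAs (Module.Projective R (X →₀ R)), hf,
        LinearMap.exact_map_mkQ_range f, Submodule.mkQ_surjective _⟩)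
    (fun B => by
      refine ⟨ModuleCat.of R (LinearMap.ker (Finsupp.linearCombination R (id : B → B))),
        ModuleCat.of R (B →₀ R), Submodule.subtype _, Finsupp.linearCombination R (id : B → B),
        inferInstanceAs (Module.Projective R (B →₀ R)), Submodule.injective_subtype _,
        LinearMap.exact_subtype_ker_map _, Finsupp.linearCombination_id_surjective R B⟩)
    (ModuleCat.of R M)
  choose P ι π hP hι hex hπ using hZ
  have hd : ∀ i x, ι (i + 1) (π i x) = 0 ↔ π i x = 0 := fun i x => map_eq_zero_iff _ (hι (i + 1))
  have hexact : ∀ i, Function.Exact (ι (i + 1) ∘ₗ π i) (ι (i + 1 + 1) ∘ₗ π (i + 1)) := by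
    intro i y
    rw [LinearMap.comp_apply, hd, hex (i + 1) y]
    constructor
    · rintro ⟨z, rfl⟩
      obtain ⟨x, rfl⟩ := hπ i z
      exact ⟨x, rfl⟩
    · rintro ⟨x, rfl⟩
      exact ⟨_, rfl⟩
  refine ⟨fun i => P i, inferInstance, inferInstance, fun i => ι (i + 1) ∘ₗ π i, hP, hexact,
    ?_, ?_⟩
  · have e : M ≃ₗ[R] Z 0 := by rw [hZ0]
    have hk : LinearMap.range (ι 0) = LinearMap.ker (ι (0 + 1) ∘ₗ π 0) := by
      ext x
      rw [LinearMap.mem_ker, LinearMap.comp_apply, hd, hex 0 x]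
      rfl
    exact ⟨e.trans ((LinearEquiv.ofInjective (ι 0) (hι 0)).trans (LinearEquiv.ofEq _ _ hk))⟩
  · intro Q _ _ hQ i g
    constructor
    · intro hg
      obtain ⟨k, hk⟩ := exists_factor (ha Q hQ) (ι (i + 1 + 1) ∘ₗ π (i + 1)) g (fun x hx => by
        obtain ⟨y, rfl⟩ := (hexact i x).mp hx
        exact LinearMap.congr_fun hg y)
      exact ⟨k, LinearMap.ext hk⟩
    · rintro ⟨k, rfl⟩
      ext x
      change k _ = 0
      have : (ι (i + 1 + 1) ∘ₗ π (i + 1)) ((ι (i + 1) ∘ₗ π i) x) = 0 :=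
        (hexact i _).mpr ⟨x, rfl⟩
      exact (congrArg k this).trans (map_zero k)

theorem gp_emb {R : Type u} [Ring R] {M : Type u} [AddCommGroup M] [Module R M]
    (h : GorensteinProjective R M) :
    ∃ (X : Type u) (f : M →ₗ[R] (X →₀ R)), Function.Injective f := by
  obtain ⟨P, _, _, d, hP, -, ⟨e⟩, -⟩ := h
  obtain ⟨s, hs⟩ := (hP 0).out
  exact ⟨P 0, s ∘ₗ (LinearMap.ker (d 0)).subtype ∘ₗ e.toLinearMap,
    hs.injective.comp ((Submodule.injective_subtype _).comp e.injective)⟩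

theorem gp_cover {R : Type u} [Ring R] {M : Type u} [AddCommGroup M] [Module R M]
    (h : GorensteinProjective R M) :
    ∃ (P : Type u) (_ : AddCommGroup P) (_ : Module R P) (π : P →ₗ[R] M),
      Module.Projective R P ∧ Function.Surjective π ∧
      ∀ (Q : Type u) [AddCommGroup Q] [Module R Q], Module.Projective R Q →
        ∀ g : LinearMap.ker π →ₗ[R] Q, ∃ k : P →ₗ[R] Q, ∀ x : LinearMap.ker π, k x = g x := by
  obtain ⟨P, _, _, d, hP, hex, he, hQ⟩ := h
  obtain ⟨i, hi⟩ : ∃ i : ℤ, 0 = i + 1 + 1 + 1 := ⟨-3, rfl⟩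
  rw [hi] at he
  obtain ⟨e⟩ := he
  have hm : ∀ x, d (i + 1 + 1) x ∈ LinearMap.ker (d (i + 1 + 1 + 1)) :=
    fun x => (hex (i + 1 + 1) _).mpr ⟨x, rfl⟩
  let π : P (i + 1 + 1) →ₗ[R] M := e.symm.toLinearMap ∘ₗ (d (i + 1 + 1)).codRestrict _ hm
  have hπ : ∀ x, π x = 0 ↔ d (i + 1 + 1) x = 0 := by
    intro x
    change e.symm _ = 0 ↔ _
    rw [LinearEquiv.map_eq_zero_iff, ← Submodule.coe_eq_zero]
    rfl
  refine ⟨P (i + 1 + 1), inferInstance, inferInstance, π, hP _, ?_, ?_⟩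
  · refine e.symm.surjective.comp ?_
    rintro ⟨y, hy⟩
    obtain ⟨x, rfl⟩ := (hex (i + 1 + 1) y).mp hy
    exact ⟨x, rfl⟩
  · intro Q _ _ hQp g
    have hm' : ∀ x, d (i + 1) x ∈ LinearMap.ker π :=
      fun x => (hπ _).mpr ((hex (i + 1) _).mpr ⟨x, rfl⟩)
    obtain ⟨k, hk⟩ := (hQ Q _ _ hQp i (g ∘ₗ (d (i + 1)).codRestrict _ hm')).mp (by
      ext x
      change g _ = 0
      have : (d (i + 1)).codRestrict _ hm' (d i x) = 0 :=
        Subtype.ext ((hex i _).mpr ⟨x, rfl⟩)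
      rw [this, map_zero])
    refine ⟨k, ?_⟩
    rintro ⟨x, hx⟩
    obtain ⟨y, rfl⟩ := (hex (i + 1) x).mp ((hπ x).mp hx)
    exact LinearMap.congr_fun hk y

theorem projInj_of_gp {R : Type u} [Ring R]
    (h : ∀ (M : Type u) [AddCommGroup M] [Module R M], GorensteinProjective R M) :
    ProjInj R := by
  intro Q _ _ hQ
  refine Module.Baer.injective fun I g => ?_
  obtain ⟨P, _, _, π, hP, hπ, hext⟩ := gp_cover (h (R ⧸ I))
  obtain ⟨φ, hφ⟩ := Module.projective_lifting_property π I.mkQ hπ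
  obtain ⟨ψ, hψ⟩ := Module.projective_lifting_property I.mkQ π I.mkQ_surjective
  have hφ' : ∀ x, π (φ x) = I.mkQ x := LinearMap.congr_fun hφ
  have hψ' : ∀ x, I.mkQ (ψ x) = π x := LinearMap.congr_fun hψ
  have hK : ∀ x : LinearMap.ker π, (ψ ∘ₗ (LinearMap.ker π).subtype) x ∈ I := by
    intro x
    rw [← Submodule.Quotient.mk_eq_zero]
    exact (hψ' x).trans x.2
  obtain ⟨k, hk⟩ := hext Q hQ (g ∘ₗ LinearMap.codRestrict I _ hK)
  have hD : ∀ x : R, (ψ ∘ₗ φ - LinearMap.id : R →ₗ[R] R) x ∈ I := by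
    intro x
    rw [← Submodule.Quotient.mk_eq_zero]
    change I.mkQ (ψ (φ x) - x) = 0
    rw [map_sub, hψ', hφ', sub_self]
  refine ⟨k ∘ₗ φ - g ∘ₗ LinearMap.codRestrict I _ hD, fun x hx => ?_⟩
  have hφx : φ x ∈ LinearMap.ker π := by
    rw [LinearMap.mem_ker, hφ']
    exact (Submodule.Quotient.mk_eq_zero _).mpr hx
  have h1 := hk ⟨φ x, hφx⟩
  change k (φ x) - _ = _
  rw [show k (φ x) = _ from h1, LinearMap.comp_apply, LinearMap.comp_apply, ← map_sub]
  congr 1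
  apply Subtype.ext
  change ψ (φ x) - (ψ (φ x) - x) = x
  abel

theorem gp_congr {R : Type u} [Ring R] {M N : Type u} [AddCommGroup M] [Module R M]
    [AddCommGroup N] [Module R N] (e : M ≃ₗ[R] N) (h : GorensteinProjective R N) :
    GorensteinProjective R M := by
  obtain ⟨P, i1, i2, d, hP, hex, ⟨e'⟩, hQ⟩ := h
  exact ⟨P, i1, i2, d, hP, hex, ⟨e.trans e'⟩, hQ⟩

theorem gp_of_gldim {R : Type u} [Ring R] (h : GPgldim R = 0)
    (M : Type u) [AddCommGroup M] [Module R M] : GorensteinProjective R M := by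
  have h0 : gpDim R M = 0 := by
    have : gpDim R M ≤ GPgldim R := le_sSup ⟨M, _, _, rfl⟩
    rw [h] at this
    exact le_antisymm this (zero_le)
  have hne : ((↑) '' {n : ℕ | HasLeftResolutionLE R
      (fun N _ _ => GorensteinProjective R N) M n} : Set ℕ∞).Nonempty := by
    by_contra hcon
    rw [Set.not_nonempty_iff_eq_empty] at hcon
    rw [gpDim, hcon, sInf_empty] at h0
    exact ENat.top_ne_zero h0
  have hmem := csInf_mem hne
  rw [← gpDim, h0] at hmem
  obtain ⟨n, hn, hn0⟩ := hmem
  obtain rfl : n = 0 := by exact_mod_cast hn0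
  obtain ⟨G, _, _, d, π, hG, hsub, hπ, hex, -⟩ := hn
  have := hsub (0 + 1) (by norm_num)
  refine gp_congr (LinearEquiv.ofBijective π ⟨?_, hπ⟩).symm (hG 0)
  rw [← LinearMap.ker_eq_bot, LinearMap.ker_eq_bot']
  intro x hx
  obtain ⟨y, rfl⟩ := (hex x).mp hx
  rw [Subsingleton.elim y 0, map_zero]

theorem gldim_of_gp {R : Type u} [Ring R]
    (h : ∀ (M : Type u) [AddCommGroup M] [Module R M], GorensteinProjective R M) :
    GPgldim R = 0 := by
  refine le_antisymm (sSup_le ?_) (zero_le)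
  rintro _ ⟨M, _, _, rfl⟩
  refine sInf_le ⟨0, ?_, by simp⟩
  refine ⟨fun n => ↥(if n = 0 then ⊤ else ⊥ : Submodule R M), inferInstance, inferInstance,
    fun _ => 0, Submodule.subtype _, fun _ => h _, ?_, ?_, ?_, ?_⟩
  · intro i hi
    change Subsingleton ↥(if i = 0 then ⊤ else ⊥ : Submodule R M)
    rw [if_neg (by omega)]
    infer_instance
  · intro m
    exact ⟨⟨m, by simp⟩, rfl⟩
  · intro x
    constructor
    · intro hx
      exact ⟨0, (Subtype.ext hx).symm⟩
    · rintro ⟨y, rfl⟩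
      rfl
  · intro i x
    have : Subsingleton ↥(if i + 1 = 0 then ⊤ else ⊥ : Submodule R M) := by
      rw [if_neg (by omega)]
      infer_instance
    exact ⟨fun _ => ⟨0, Subsingleton.elim _ _⟩, fun _ => rfl⟩

end QF

/-- `R` is quasi-Frobenius (left and right Noetherian, and left and right self-injective)
if and only if the left Gorenstein global dimension of `R` is zero. -/
theorem quasiFrobenius_iff_GPgldim_eq_zero (R : Type u) [Ring R] :
    (IsNoetherianRing R ∧ IsNoetherianRing Rᵐᵒᵖ ∧
      Module.Injective R R ∧ Module.Injective Rᵐᵒᵖ Rᵐᵒᵖ) ↔ GPgldim R = 0 := by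
  constructor
  · rintro ⟨h1, -, h3, h4⟩
    have hb := QF.embFree_of h3 h4
    exact QF.gldim_of_gp fun M _ _ => QF.gp_of (QF.projInj_of h3) hb M
  · intro h
    have hgp := fun (M : Type u) [AddCommGroup M] [Module R M] => QF.gp_of_gldim h M
    have ha : QF.ProjInj R := QF.projInj_of_gp hgp
    have hb : QF.EmbFree R := fun M _ _ => QF.gp_emb (hgp M)
    have h1 : IsNoetherianRing R := QF.noetherian_of ha hb
    have h3 : Module.Injective R R := ha R inferInstance
    have hA : IsArtinianRing R := QF.artinian h3
    have h2 : IsNoetherianRing Rᵐᵒᵖ := QF.right_noetherian_of h3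
    exact ⟨h1, h2, h3, QF.right_injective_of hb⟩
end

section
/- A ring R is quasi-Frobenius if and only if every right R-module is Gorenstein projective (i.e., the right Gorenstein global dimension of R is zero). -/
/-! Definitions for Gorenstein homological algebra over an arbitrary
associative ring `R` (left modules; right modules are `Rᵐᵒᵖ`-modules). -/

universe u

namespace QFProof

section Basic

variable {A : Type u} [Ring A]

/-- Descend a map along a surjection. -/
theorem desc {W Y Q : Type u} [AddCommGroup W] [Module A W] [AddCommGroup Y] [Module A Y]
    [AddCommGroup Q] [Module A Q] (σ : W →ₗ[A] Y) (hσ : Function.Surjective σ) (ψ : W →ₗ[A] Q)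
    (h : ∀ w, σ w = 0 → ψ w = 0) : ∃ φ : Y →ₗ[A] Q, ∀ w, φ (σ w) = ψ w := by
  refine ⟨((LinearMap.ker σ).liftQ ψ (fun w hw => h w hw)).comp
    (σ.quotKerEquivOfSurjective hσ).symm.toLinearMap, fun w => ?_⟩
  have : (σ.quotKerEquivOfSurjective hσ).symm (σ w) = (LinearMap.ker σ).mkQ w := by
    rw [LinearEquiv.symm_apply_eq]; rfl
  rw [LinearMap.comp_apply, LinearEquiv.coe_coe, this]
  rfl

/-- Lift a map along an injection. -/
theorem lft {W X Y : Type u} [AddCommGroup W] [Module A W] [AddCommGroup X] [Module A X]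
    [AddCommGroup Y] [Module A Y] (f : X →ₗ[A] Y) (hf : Function.Injective f) (s : W →ₗ[A] Y)
    (h : ∀ w, ∃ x, f x = s w) : ∃ t : W →ₗ[A] X, ∀ w, f (t w) = s w := by
  refine ⟨(LinearEquiv.ofInjective f hf).symm.toLinearMap.comp
    (s.codRestrict (LinearMap.range f) (fun w => h w)), fun w => ?_⟩
  have := congrArg Subtype.val ((LinearEquiv.ofInjective f hf).apply_symm_apply
    (s.codRestrict (LinearMap.range f) (fun w => h w) w))
  exact this

/-- In an injective module maps extend along maps whose kernel is killed. -/
theorem ext_inj {W Y Q : Type u} [AddCommGroup W] [Module A W] [AddCommGroup Y] [Module A Y]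
    [AddCommGroup Q] [Module A Q] (hQ : Module.Injective A Q) (σ : W →ₗ[A] Y) (ψ : W →ₗ[A] Q)
    (h : ∀ w, σ w = 0 → ψ w = 0) : ∃ φ : Y →ₗ[A] Q, ∀ w, φ (σ w) = ψ w := by
  obtain ⟨φ, hφ⟩ := desc σ.rangeRestrict σ.surjective_rangeRestrict ψ
    (fun w hw => h w (by simpa using congrArg Subtype.val hw))
  obtain ⟨φ', h'⟩ := hQ.out (LinearMap.range σ).subtype Subtype.val_injective φ
  exact ⟨φ', fun w => by rw [← hφ w, ← h']; rfl⟩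

theorem retract_inj {Q F : Type u} [AddCommGroup Q] [Module A Q] [AddCommGroup F] [Module A F]
    (hF : Module.Injective A F) (i : Q →ₗ[A] F) (r : F →ₗ[A] Q) (h : ∀ q, r (i q) = q) :
    Module.Injective A Q := by
  constructor
  intro X Y _ _ _ _ f hf g
  obtain ⟨k, hk⟩ := hF.out f hf (i.comp g)
  exact ⟨r.comp k, fun x => by simp [hk, h]⟩

/-- Finitely generated right ideals are annihilators over a left self-injective ring. -/
theorem ann_fg (hA : Module.Injective A A) (s : Finset A) (y : A)
    (h : ∀ a : A, (∀ x ∈ s, a * x = 0) → a * y = 0) : ∃ c : A → A, y = ∑ x ∈ s, x * c x := by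
  classical
  obtain ⟨φ, hφ⟩ := ext_inj hA
    (LinearMap.pi (fun x : s => LinearMap.toSpanSingleton A A (x : A)))
    (LinearMap.toSpanSingleton A A y) (fun w hw => by
      have := h w (fun x hx => by simpa using congrFun hw ⟨x, hx⟩)
      simpa using this)
  refine ⟨fun x => if hx : x ∈ s then φ (Pi.single ⟨x, hx⟩ 1) else 0, ?_⟩
  have h1 := hφ 1
  have h2 : (LinearMap.pi (fun x : s => LinearMap.toSpanSingleton A A (x : A))) (1 : A)
      = ∑ x : s, (x : A) • (Pi.single x (1 : A) : s → A) := by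
    ext z
    simp [Finset.sum_apply, Pi.single_apply]
  rw [h2, map_sum] at h1
  simp only [map_smul, LinearMap.toSpanSingleton_apply, one_smul] at h1
  rw [← h1, ← Finset.sum_attach s]
  simp

end Basic

section GP

variable {A : Type u} [Ring A]

theorem gp_of_gldim (h : GPgldim A = 0) (M : Type u) [AddCommGroup M] [Module A M] :
    GorensteinProjective A M := by
  have h0 : gpDim A M = 0 := by
    have : gpDim A M ≤ GPgldim A := le_sSup ⟨M, _, _, rfl⟩
    rw [h] at this
    exact le_antisymm this bot_le
  unfold gpDim at h0
  rw [ENat.sInf_eq_zero] at h0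
  obtain ⟨n, hn, hn0⟩ := h0
  obtain rfl : n = 0 := by exact_mod_cast hn0
  obtain ⟨G, _, _, d, π, hG, hs, hsurj, hex, -⟩ := hn
  have hinj : Function.Injective π := by
    rw [injective_iff_map_eq_zero]
    intro x hx
    obtain ⟨y, rfl⟩ := (hex x).1 hx
    have := hs (0 + 1) (by norm_num)
    rw [Subsingleton.elim y 0, map_zero]
  obtain ⟨P, i1, i2, d', h1, h2, ⟨e⟩, h4⟩ := hG 0
  exact ⟨P, i1, i2, d', h1, h2, ⟨(LinearEquiv.ofBijective π ⟨hinj, hsurj⟩).symm.trans e⟩, h4⟩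

theorem gldim_of_gp (h : ∀ (M : Type u) [AddCommGroup M] [Module A M],
    GorensteinProjective A M) : GPgldim A = 0 := by
  refine le_antisymm (sSup_le ?_) bot_le
  rintro _ ⟨M, _, _, rfl⟩
  refine sInf_le ⟨0, ?_, by simp⟩
  let G : ℕ → ModuleCat.{u} A := fun n => match n with
    | 0 => ModuleCat.of A M
    | _ + 1 => ModuleCat.of A PUnit.{u + 1}
  have hsub : ∀ i, Subsingleton (G (i + 1)) := fun i => inferInstanceAs (Subsingleton PUnit)
  let π : (G 0) →ₗ[A] M := (LinearMap.id : M →ₗ[A] M)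
  refine ⟨fun i => G i, fun i => inferInstance, fun i => inferInstance, fun i => 0,
    π, fun i => h _, ?_, fun x => ⟨x, rfl⟩, ?_, ?_⟩
  · intro i hi
    obtain ⟨k, rfl⟩ : ∃ k, i = k + 1 := ⟨i - 1, by omega⟩
    exact hsub k
  · intro x
    constructor
    · intro hx
      exact ⟨0, hx.symm⟩
    · rintro ⟨y, rfl⟩
      rfl
  · intro i x
    have := hsub i
    exact ⟨fun _ => ⟨0, Subsingleton.elim _ _⟩, fun _ => rfl⟩

theorem embeds_of_gp (M : Type u) [AddCommGroup M] [Module A M] (h : GorensteinProjective A M) :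
    ∃ (P : Type u) (_ : AddCommGroup P) (_ : Module A P) (f : M →ₗ[A] P),
      Module.Projective A P ∧ Function.Injective f := by
  obtain ⟨P, i1, i2, d', h1, h2, ⟨e⟩, h4⟩ := h
  exact ⟨P 0, _, _, (LinearMap.ker (d' 0)).subtype.comp e.toLinearMap, h1 0,
    Subtype.val_injective.comp e.injective⟩

theorem inj_of_gp (h : ∀ (M : Type u) [AddCommGroup M] [Module A M],
    GorensteinProjective A M) (Q : Type u) [AddCommGroup Q] [Module A Q]
    (hQ : Module.Projective A Q) : Module.Injective A Q := by
  constructor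
  intro X Y _ _ _ _ f hf g
  obtain ⟨P, i1, i2, d, h1, h2, ⟨e⟩, h4⟩ := h (Y ⧸ LinearMap.range f)
  generalize (0 : ℤ) = k at e
  obtain ⟨i, rfl⟩ : ∃ i, k = i + 1 + 1 + 1 := ⟨k - 3, by ring⟩
  have hp : ∀ w, d (i + 1 + 1) w ∈ LinearMap.ker (d (i + 1 + 1 + 1)) := fun w =>
    (h2 (i + 1 + 1) _).2 ⟨w, rfl⟩
  let p : P (i + 1 + 1) →ₗ[A] Y ⧸ LinearMap.range f :=
    e.symm.toLinearMap.comp ((d (i + 1 + 1)).codRestrict _ hp)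
  have hp0 : ∀ w, p w = 0 ↔ ∃ v, d (i + 1) v = w := by
    intro w
    rw [← Set.mem_range, ← h2 (i + 1) w]
    simp only [p, LinearMap.comp_apply, LinearEquiv.coe_coe, LinearEquiv.map_eq_zero_iff]
    exact ⟨fun h => by simpa using congrArg Subtype.val h, fun h => Subtype.ext h⟩
  have hpe : ∀ w, e (p w) = (d (i + 1 + 1)).codRestrict _ hp w := fun w => by simp [p]
  have hps : Function.Surjective p := by
    intro c
    obtain ⟨w, hw⟩ := (h2 (i + 1 + 1) (e c)).1 (e c).2
    exact ⟨w, e.injective (by rw [hpe]; exact Subtype.ext hw)⟩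
  have := h1 (i + 1 + 1)
  obtain ⟨l, hl⟩ := Module.projective_lifting_property (LinearMap.range f).mkQ p
    (Submodule.mkQ_surjective _)
  have hl' : ∀ w, (LinearMap.range f).mkQ (l w) = p w := fun w => LinearMap.congr_fun hl w
  obtain ⟨t, ht⟩ := lft f hf (l.comp (d (i + 1))) (fun w => by
    have : (LinearMap.range f).mkQ (l (d (i + 1) w)) = 0 := by
      rw [hl', hp0]; exact ⟨w, rfl⟩
    simpa using this)
  have h5 := (h4 Q _ _ hQ i (g.comp t)).1 (by
    ext w
    have : f (t (d i w)) = 0 := by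
      rw [ht, LinearMap.comp_apply, (h2 i _).2 ⟨w, rfl⟩, map_zero]
    have h6 : t (d i w) = 0 := hf (by rw [this, map_zero])
    simp [h6])
  obtain ⟨k, hk⟩ := h5
  have hk' : ∀ w, k (d (i + 1) w) = g (t w) := fun w => LinearMap.congr_fun hk w
  obtain ⟨φ, hφ⟩ := desc (f.coprod l) (fun y => by
      obtain ⟨w, hw⟩ := hps ((LinearMap.range f).mkQ y)
      rw [← hl'] at hw
      have : y - l w ∈ LinearMap.range f := by
        rw [← (Submodule.Quotient.eq _)]
        exact hw.symm
      obtain ⟨x, hx⟩ := this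
      exact ⟨(x, w), by simp [hx]⟩)
    (g.coprod k) (by
      rintro ⟨x, w⟩ hw
      simp only [LinearMap.coprod_apply] at hw ⊢
      have : p w = 0 := by
        rw [← hl', eq_neg_of_add_eq_zero_right hw]
        simp
      obtain ⟨v, rfl⟩ := (hp0 w).1 this
      rw [hk', ← map_add]
      have h7 := ht v
      rw [LinearMap.comp_apply] at h7
      rw [← h7, ← map_add] at hw
      rw [hf (hw.trans (map_zero f).symm), map_zero])
  exact ⟨φ, fun x => by simpa using hφ (x, 0)⟩

/-- Every left ideal is the annihilator of a finite set. -/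
def CycEmb (A : Type u) [Ring A] : Prop :=
  ∀ I : Ideal A, ∃ s : Finset A, ∀ a, a ∈ I ↔ ∀ x ∈ s, a * x = 0

theorem cycEmb_of_gp (h : ∀ (M : Type u) [AddCommGroup M] [Module A M],
    GorensteinProjective A M) : CycEmb A := by
  classical
  intro I
  obtain ⟨P, _, _, f, hP, hf⟩ := embeds_of_gp (A ⧸ I) (h _)
  obtain ⟨s, hs⟩ := hP.out
  let v := s (f (I.mkQ 1))
  refine ⟨v.support.image v, fun a => ?_⟩
  have h1 : a ∈ I ↔ a • v = 0 := by
    have : a • v = s (f (I.mkQ a)) := by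
      simp only [v, ← map_smul]; simp
    rw [this]
    constructor
    · intro ha
      have : I.mkQ a = 0 := by simpa using ha
      rw [this]; simp
    · intro ha
      have h2 : f (I.mkQ a) = 0 := hs.injective (by rw [ha, map_zero])
      have h3 : I.mkQ a = 0 := hf (by rw [h2, map_zero])
      simpa using h3
  rw [h1]
  constructor
  · intro ha x hx
    obtain ⟨i, -, rfl⟩ := Finset.mem_image.1 hx
    simpa using DFunLike.congr_fun ha i
  · intro ha
    ext i
    by_cases hi : i ∈ v.support
    · exact ha _ (Finset.mem_image_of_mem _ hi)
    · simp [Finsupp.notMem_support_iff.1 hi]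

theorem noeth_of_gp (h : ∀ (M : Type u) [AddCommGroup M] [Module A M],
    GorensteinProjective A M) : IsNoetherianRing A := by
  classical
  rw [isNoetherianRing_iff, ← monotone_stabilizes_iff_noetherian]
  intro I
  choose P i1 i2 f hP hf using fun n => embeds_of_gp (A ⧸ (I n : Ideal A)) (h _)
  have hinj : Module.Injective A (Π₀ n, P n) := inj_of_gp h _
    (inferInstanceAs (Module.Projective A (DirectSum ℕ P)))
  have hfI : ∀ n a, f n ((I n : Ideal A).mkQ a) = 0 ↔ a ∈ I n := by
    intro n a
    rw [← map_zero (f n), (hf n).eq_iff]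
    simp
  let U : Ideal A := ⨆ n, I n
  obtain ⟨t, ht⟩ := lft (DFinsupp.coeFnLinearMap A : (Π₀ n, P n) →ₗ[A] ∀ n, P n)
    DFunLike.coe_injective
    ((LinearMap.pi (fun n => (f n).comp (I n : Ideal A).mkQ)).comp U.subtype) (by
      rintro ⟨x, hx⟩
      obtain ⟨m, hm⟩ := (Submodule.mem_iSup_of_directed _ I.monotone.directed_le).1 hx
      refine ⟨DFinsupp.mk (Finset.range m) (fun n => f n ((I n : Ideal A).mkQ x)), ?_⟩
      ext n
      simp only [DFinsupp.coeFnLinearMap_apply, DFinsupp.mk_apply, LinearMap.comp_apply,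
        LinearMap.pi_apply, Submodule.subtype_apply]
      split_ifs with hn
      · rfl
      · symm
        rw [hfI]
        exact I.monotone (by simpa using hn) hm)
  obtain ⟨k, hk⟩ := hinj.out U.subtype Subtype.val_injective t
  obtain ⟨N, hN⟩ : ∃ N, ∀ n, N ≤ n → (k 1) n = 0 := by
    refine ⟨(k 1).support.sup id + 1, fun n hn => ?_⟩
    by_contra hne
    have : n ≤ (k 1).support.sup id := Finset.le_sup (f := id) (by simpa using hne)
    omega
  refine ⟨N, fun m hm => le_antisymm (I.monotone hm) ?_⟩
  intro x hx
  have hxU : x ∈ U := Submodule.mem_iSup_of_mem m hx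
  rw [← hfI]
  have h1 := congrFun (ht ⟨x, hxU⟩) N
  have h2 : k x = x • k 1 := by rw [← map_smul]; simp
  rw [← hk] at h1
  simp only [DFinsupp.coeFnLinearMap_apply, LinearMap.comp_apply,
        LinearMap.pi_apply, Submodule.subtype_apply] at h1
  rw [← h1, h2]
  simp [hN N le_rfl]

end GP


section Fwd

variable {A : Type u} [Ring A]

theorem free_inj (hN : IsNoetherianRing A) (hA : Module.Injective A A) (ι : Type u) :
    Module.Injective A (ι →₀ A) := by
  classical
  apply Module.Baer.injective
  intro I g
  have hfin : Module.Finite A I := Module.Finite.of_fg (hN.noetherian I)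
  obtain ⟨s, hs⟩ := hfin.fg_top
  let T : Finset ι := s.biUnion (fun x => (g x).support)
  have hT : ∀ x, g x ∈ Finsupp.supported A A (T : Set ι) := by
    intro x
    have : (⊤ : Submodule A I) ≤ (Finsupp.supported A A (T : Set ι)).comap g := by
      rw [← hs, Submodule.span_le]
      intro y hy
      simp only [Submodule.comap_coe, Set.mem_preimage, SetLike.mem_coe, Finsupp.mem_supported]
      exact_mod_cast Finset.subset_biUnion_of_mem (fun x => (g x).support) hy
    exact this trivial
  have hc : ∀ i : ι, ∃ c : A, ∀ x : I, g x i = (x : A) * c := by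
    intro i
    obtain ⟨k, hk⟩ := hA.out I.subtype Subtype.val_injective ((Finsupp.lapply i).comp g)
    refine ⟨k 1, fun x => ?_⟩
    have := hk x
    rw [Submodule.subtype_apply] at this
    rw [← smul_eq_mul, ← map_smul, smul_eq_mul, mul_one, this]
    rfl
  choose c hc using hc
  refine ⟨LinearMap.toSpanSingleton A _ (Finsupp.onFinset T (fun i => if i ∈ T then c i else 0)
    (fun i hi => by by_contra h; simp [h] at hi)), fun x hx => ?_⟩
  ext i
  simp only [LinearMap.toSpanSingleton_apply, Finsupp.smul_apply, Finsupp.onFinset_apply,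
    smul_eq_mul]
  split_ifs with hi
  · rw [hc]
  · rw [mul_zero]
    symm
    have := (Finsupp.mem_supported A _).1 (hT ⟨x, hx⟩)
    by_contra hne
    exact hi (by exact_mod_cast this (Finsupp.mem_support_iff.2 hne))

theorem proj_inj (hN : IsNoetherianRing A) (hA : Module.Injective A A) (Q : Type u)
    [AddCommGroup Q] [Module A Q] (hQ : Module.Projective A Q) : Module.Injective A Q := by
  obtain ⟨s, hs⟩ := hQ.out
  exact retract_inj (free_inj hN hA Q) s (Finsupp.linearCombination A id) hs

theorem cyc_embeds (hC : CycEmb A) {M : Type u} [AddCommGroup M] [Module A M] (m : M) :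
    ∃ (P : Type u) (_ : AddCommGroup P) (_ : Module A P) (f : (A ∙ m) →ₗ[A] P),
      Module.Projective A P ∧ Function.Injective f := by
  classical
  obtain ⟨s, hs⟩ := hC (LinearMap.ker (LinearMap.toSpanSingleton A M m))
  have hx : ∀ a : A, (LinearMap.toSpanSingleton A M m) a ∈ A ∙ m := fun a =>
    Submodule.mem_span_singleton.2 ⟨a, rfl⟩
  have hsurj : Function.Surjective ((LinearMap.toSpanSingleton A M m).codRestrict _ hx) := by
    rintro ⟨y, hy⟩
    obtain ⟨a, ha⟩ := Submodule.mem_span_singleton.1 hy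
    exact ⟨a, Subtype.ext ha⟩
  have hk : ∀ a : A, (LinearMap.toSpanSingleton A M m).codRestrict _ hx a = 0 ↔
      LinearMap.pi (fun x : s => LinearMap.toSpanSingleton A A (x : A)) a = 0 := by
    intro a
    have h1 : (LinearMap.toSpanSingleton A M m).codRestrict _ hx a = 0 ↔
        a ∈ LinearMap.ker (LinearMap.toSpanSingleton A M m) :=
      ⟨fun h => congrArg Subtype.val h, fun h => Subtype.ext h⟩
    rw [h1, hs]
    constructor
    · intro h; ext x; exact h x x.2
    · intro h x hx; exact congrFun h ⟨x, hx⟩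
  obtain ⟨φ, hφ⟩ := desc ((LinearMap.toSpanSingleton A M m).codRestrict _ hx) hsurj
    (LinearMap.pi (fun x : s => LinearMap.toSpanSingleton A A (x : A))) (fun w hw => (hk w).1 hw)
  refine ⟨s → A, _, _, φ, inferInstance, ?_⟩
  rw [injective_iff_map_eq_zero]
  intro y hy
  obtain ⟨a, rfl⟩ := hsurj y
  rw [hφ] at hy
  exact (hk a).2 hy

theorem sSupIndep_fin {α : Type u} [CompleteLattice α] {t : Finset α} :
    sSupIndep (t : Set α) ↔ t.SupIndep id := by
  rw [sSupIndep_iff, ← iSupIndep_comp_coe_iff_supIndep]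
  rfl

theorem sSupIndep_insert' {M : Type u} [AddCommGroup M] [Module A M] {s : Set (Submodule A M)}
    {N : Submodule A M} (hs : sSupIndep s) (h : Disjoint N (sSup s)) :
    sSupIndep (insert N s) := by
  classical
  rw [sSupIndep_iff_finite]
  intro t ht
  have h1 : ((t.erase N : Finset _) : Set (Submodule A M)) ⊆ s := by
    intro x hx
    simp only [Finset.coe_erase, Set.mem_sdiff, Finset.mem_coe, Set.mem_singleton_iff] at hx
    exact (ht hx.1).resolve_left hx.2
  have h2 : (t.erase N).SupIndep id := sSupIndep_fin.1 (hs.mono h1)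
  have h3 : (insert N (t.erase N)).SupIndep id := h2.insert (h.mono_right
    (Finset.sup_le fun x hx => le_sSup (h1 hx)))
  have h4 : t ⊆ insert N (t.erase N) := fun x hx => by by_cases hxN : x = N <;> simp [hxN, hx]
  exact sSupIndep_fin.2 (h3.subset h4)

theorem embeds (hN : IsNoetherianRing A) (hA : Module.Injective A A) (hC : CycEmb A)
    (M : Type u) [AddCommGroup M] [Module A M] :
    ∃ (P : Type u) (_ : AddCommGroup P) (_ : Module A P) (f : M →ₗ[A] P),
      Module.Projective A P ∧ Function.Injective f := by
  classical
  obtain ⟨s, hs⟩ := zorn_subset {s : Set (Submodule A M) | sSupIndep s ∧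
    ∀ N ∈ s, N ≠ ⊥ ∧ ∃ m, N = A ∙ m} (by
      intro c hc hchain
      refine ⟨⋃₀ c, ⟨iSupIndep_sUnion_of_directed hchain.directedOn (fun a ha => (hc ha).1), ?_⟩,
        fun a ha => Set.subset_sUnion_of_mem ha⟩
      rintro N ⟨a, ha, hN⟩
      exact (hc ha).2 N hN)
  have hind : iSupIndep (fun N : s => (N : Submodule A M)) := (sSupIndep_iff _).1 hs.prop.1
  have hemb : ∀ N : s, ∃ (P : Type u) (_ : AddCommGroup P) (_ : Module A P)
      (f : (N : Submodule A M) →ₗ[A] P), Module.Projective A P ∧ Function.Injective f := by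
    rintro ⟨N, hNs⟩
    obtain ⟨m, rfl⟩ := (hs.prop.2 N hNs).2
    exact cyc_embeds hC m
  choose P i1 i2 f hP hf using hemb
  have hproj : Module.Projective A (Π₀ N, P N) :=
    inferInstanceAs (Module.Projective A (DirectSum s P))
  have hinj := proj_inj hN hA _ hproj
  let F : (Π₀ N : s, (N : Submodule A M)) →ₗ[A] (Π₀ N, P N) := DFinsupp.mapRange.linearMap f
  have hF : Function.Injective F := by
    intro x y hxy
    ext N : 1
    apply hf N
    have := DFunLike.congr_fun hxy N
    simpa [F] using this
  obtain ⟨k, hk⟩ := hinj.out (DFinsupp.lsum ℕ fun N : s => (N : Submodule A M).subtype)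
    hind.dfinsupp_lsum_injective F
  refine ⟨_, _, _, k, hproj, ?_⟩
  rw [injective_iff_map_eq_zero]
  intro m hm
  by_contra hm0
  have hdisj : Disjoint (A ∙ m) (sSup s) := by
    rw [Submodule.disjoint_def]
    intro x hx hxs
    rw [sSup_eq_iSup', Submodule.iSup_eq_range_dfinsupp_lsum] at hxs
    obtain ⟨w, rfl⟩ := hxs
    obtain ⟨a, ha⟩ := Submodule.mem_span_singleton.1 hx
    have h1 : F w = 0 := by
      rw [← hk, ← ha, map_smul, hm, smul_zero]
    rw [hF (h1.trans (map_zero F).symm), map_zero]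
  have hmem : (A ∙ m) ∈ s := by
    have := hs.le_of_ge (y := insert (A ∙ m) s) ⟨sSupIndep_insert' hs.prop.1 hdisj, by
      rintro N (rfl | hN)
      · exact ⟨by simpa using hm0, m, rfl⟩
      · exact hs.prop.2 N hN⟩ (Set.subset_insert _ _)
    exact this (Set.mem_insert _ _)
  have h2 := hdisj.mono_right (le_sSup hmem)
  rw [disjoint_self] at h2
  exact hm0 (by simpa using h2)

theorem int_chain {α : Type*} (rel : α → α → Prop) (h1 : ∀ a, ∃ b, rel a b)
    (h2 : ∀ b, ∃ a, rel a b) (m : α) : ∃ Z : ℤ → α, Z 0 = m ∧ ∀ i, rel (Z i) (Z (i + 1)) := by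
  choose f hf using h1
  choose g hg using h2
  refine ⟨fun i => Int.casesOn i (fun n => f^[n] m) (fun n => g^[n + 1] m), rfl, ?_⟩
  rintro (n | n)
  · show rel (f^[n] m) (f^[n + 1] m)
    rw [Function.iterate_succ_apply']
    exact hf _
  · rcases n with _ | n
    · exact hg m
    · show rel (g^[n + 2] m) (g^[n + 1] m)
      rw [Function.iterate_succ_apply' g (n + 1)]
      exact hg _

theorem gp_of_qf (hN : IsNoetherianRing A) (hA : Module.Injective A A) (hC : CycEmb A)
    (M : Type u) [AddCommGroup M] [Module A M] : GorensteinProjective A M := by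
  let rel : ModuleCat.{u} A → ModuleCat.{u} A → Prop := fun X Y =>
    ∃ (P : Type u) (_ : AddCommGroup P) (_ : Module A P) (f : X →ₗ[A] P) (g : P →ₗ[A] Y),
      Module.Projective A P ∧ Function.Injective f ∧ Function.Exact f g ∧ Function.Surjective g
  obtain ⟨Z, hZ0, hZ⟩ := int_chain rel
    (fun X => by
      obtain ⟨P, _, _, f, hP, hf⟩ := embeds hN hA hC X
      exact ⟨ModuleCat.of A (P ⧸ LinearMap.range f), P, _, _, f, (LinearMap.range f).mkQ, hP, hf,
        LinearMap.exact_map_mkQ_range f, Submodule.mkQ_surjective _⟩)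
    (fun Y => ⟨ModuleCat.of A (LinearMap.ker (Finsupp.linearCombination A (id : Y → Y))),
        Y →₀ A, _, _, (LinearMap.ker (Finsupp.linearCombination A (id : Y → Y))).subtype,
        Finsupp.linearCombination A (id : Y → Y), inferInstance, Subtype.val_injective,
        LinearMap.exact_subtype_ker_map _, Finsupp.linearCombination_id_surjective A Y⟩)
    (ModuleCat.of A M)
  choose P i1 i2 f g hP hf hex hg using hZ
  have hker : ∀ i x, f (i + 1) (g i x) = 0 ↔ g i x = 0 := fun i x =>
    ⟨fun h => hf _ (h.trans (map_zero _).symm), fun h => by rw [h, map_zero]⟩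
  refine ⟨P, i1, i2, fun i => (f (i + 1)).comp (g i), hP, ?_, ?_, ?_⟩
  · intro i x
    rw [LinearMap.comp_apply, hker, hex (i + 1) x]
    constructor
    · rintro ⟨z, rfl⟩
      obtain ⟨w, rfl⟩ := hg i z
      exact ⟨w, rfl⟩
    · rintro ⟨w, rfl⟩
      exact ⟨g i w, rfl⟩
  · have e : Z 0 ≃ₗ[A] LinearMap.ker ((f (0 + 1)).comp (g 0)) := by
      refine LinearEquiv.ofBijective ((f 0).codRestrict _ (fun z => ?_)) ⟨?_, ?_⟩
      · rw [LinearMap.mem_ker, LinearMap.comp_apply, hker, hex 0]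
        exact ⟨z, rfl⟩
      · intro x y hxy
        exact hf 0 (congrArg Subtype.val hxy)
      · rintro ⟨x, hx⟩
        rw [LinearMap.mem_ker, LinearMap.comp_apply, hker, hex 0] at hx
        obtain ⟨z, hz⟩ := hx
        exact ⟨z, Subtype.ext hz⟩
    rw [hZ0] at e
    exact ⟨e⟩
  · intro Q _ _ hQ i k
    have hQi := proj_inj hN hA Q hQ
    constructor
    · intro hk
      obtain ⟨φ, hφ⟩ := ext_inj hQi ((f (i + 1 + 1)).comp (g (i + 1))) k (by
        intro w hw
        rw [LinearMap.comp_apply, hker, hex (i + 1)] at hw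
        obtain ⟨z, rfl⟩ := hw
        obtain ⟨v, rfl⟩ := hg i z
        exact LinearMap.congr_fun hk v)
      exact ⟨φ, LinearMap.ext hφ⟩
    · rintro ⟨φ, rfl⟩
      ext v
      have : g (i + 1) (f (i + 1) (g i v)) = 0 := (hex (i + 1) _).2 ⟨_, rfl⟩
      simp [this]

end Fwd


section Semiprimary

variable {A : Type u} [Ring A]

theorem mem_jac {x : A} : x ∈ Ring.jacobson A ↔ ∀ y : A, ∃ z : A, z * (1 + y * x) = 1 := by
  rw [← Ideal.jacobson_bot, Ideal.mem_jacobson_iff]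
  refine forall_congr' fun y => exists_congr fun z => ?_
  rw [Ideal.mem_bot, sub_eq_zero, mul_add, mul_one, mul_assoc, add_comm]

theorem jac_unit {x : A} (hx : x ∈ Ring.jacobson A) : IsUnit (1 + x) := by
  obtain ⟨z, hz⟩ := mem_jac.1 hx 1
  rw [one_mul] at hz
  obtain ⟨w, hw⟩ := mem_jac.1 hx (-z)
  have h1 : 1 + -z * x = z := by
    rw [mul_add, mul_one] at hz
    rw [← hz]; noncomm_ring
  rw [h1] at hw
  have h2 : w = 1 + x := by
    calc w = w * (z * (1 + x)) := by rw [hz, mul_one]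
      _ = 1 + x := by rw [← mul_assoc, hw, one_mul]
  rw [h2] at hw
  exact ⟨⟨1 + x, z, hw, hz⟩, rfl⟩

theorem jac_mul {x : A} (hx : x ∈ Ring.jacobson A) (y : A) : x * y ∈ Ring.jacobson A :=
  Ideal.mul_mem_right y _ hx

/-- strict inclusion of principal right ideals -/
def RP (A : Type u) [Ring A] (x y : A) : Prop := (∃ c, x = y * c) ∧ ¬ ∃ c, y = x * c

theorem wf_RP (hN : IsNoetherianRing A) (hA : Module.Injective A A) : WellFounded (RP A) := by
  have hwf : WellFounded ((· > ·) : Ideal A → Ideal A → Prop) := wellFounded_gt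
  refine Subrelation.wf ?_ (InvImage.wf
    (fun x : A => (LinearMap.ker (LinearMap.toSpanSingleton A A x) : Ideal A)) hwf)
  rintro x y ⟨⟨c, hc⟩, hn⟩
  show LinearMap.ker (LinearMap.toSpanSingleton A A y) <
    LinearMap.ker (LinearMap.toSpanSingleton A A x)
  refine lt_of_le_not_ge ?_ ?_
  · intro a ha
    simp only [LinearMap.mem_ker, LinearMap.toSpanSingleton_apply, smul_eq_mul] at ha ⊢
    rw [hc, ← mul_assoc, ha, zero_mul]
  · intro hle
    apply hn
    obtain ⟨k, hk⟩ := ann_fg hA {x} y (by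
      intro a ha
      have : a ∈ LinearMap.ker (LinearMap.toSpanSingleton A A x) := by simpa using ha
      simpa using hle this)
    exact ⟨k x, by simpa using hk⟩

theorem jac_nilp (hN : IsNoetherianRing A) (hwf : WellFounded (RP A)) :
    IsNilpotent (Ring.jacobson A) := by
  let J := Ring.jacobson A
  have hle : ∀ n, J ^ (n + 1) ≤ J ^ n := fun n => by
    rw [Ideal.IsTwoSided.pow_succ, Ideal.mul_le]
    intro r _ s hs
    exact (J ^ n).mul_mem_left r hs
  have htwo : ∀ n, (J ^ n).IsTwoSided := fun n => inferInstance
  let L : ℕ →o Ideal A :=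
    ⟨fun n =>
      { carrier := {a | ∀ x ∈ J ^ n, a * x = 0}
        add_mem' := fun {a b} ha hb x hx => by rw [add_mul, ha x hx, hb x hx, add_zero]
        zero_mem' := fun x _ => zero_mul x
        smul_mem' := fun c a ha x hx => by rw [smul_eq_mul, mul_assoc, ha x hx, mul_zero] },
      monotone_nat_of_le_succ fun n a ha x hx => ha x (hle n hx)⟩
  obtain ⟨n, hn⟩ := monotone_stabilizes_iff_noetherian.2 hN L
  have hn' : L n = L (n + 1) := hn (n + 1) (Nat.le_succ n)
  have key : ∀ a, a ∈ L n := by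
    intro a
    induction a using hwf.induction with
    | _ a ih =>
    by_contra ha
    apply ha
    rw [hn']
    intro x hx
    rw [Ideal.IsTwoSided.pow_succ] at hx
    refine Submodule.mul_induction_on hx ?_ ?_
    · intro j hj s hs
      have : a * j ∈ L n := by
        apply ih
        refine ⟨⟨j, rfl⟩, ?_⟩
        rintro ⟨c, hc⟩
        have hu : IsUnit (1 + j * (-c)) := jac_unit (jac_mul hj (-c))
        have h0 : a * (1 + j * (-c)) = 0 := by
          rw [mul_add, mul_one, mul_neg, mul_neg, ← mul_assoc, ← hc]; simp
        apply ha
        rw [(hu.mul_left_eq_zero).1 h0]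
        exact Submodule.zero_mem _
      rw [← mul_assoc]
      exact this s hs
    · intro y z hy hz
      rw [mul_add, hy, hz, add_zero]
  refine ⟨n, ?_⟩
  rw [Submodule.zero_eq_bot, eq_bot_iff]
  intro x hx
  simpa using key 1 x hx

theorem wf_quot (I : Ideal A) [I.IsTwoSided] (hwf : WellFounded (RP A)) :
    WellFounded (RP (A ⧸ I)) := by
  have : ∀ a : A, Acc (RP (A ⧸ I)) (Ideal.Quotient.mk I a) := by
    intro a
    induction a using hwf.induction with
    | _ a ih =>
    constructor
    rintro t ⟨⟨c, hc⟩, hn⟩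
    obtain ⟨c', rfl⟩ := Ideal.Quotient.mk_surjective c
    rw [← map_mul] at hc
    rw [hc]
    apply ih
    refine ⟨⟨c', rfl⟩, ?_⟩
    rintro ⟨d, hd⟩
    exact hn ⟨Ideal.Quotient.mk I d, by rw [hc, ← map_mul, ← hd]⟩
  constructor
  intro t
  obtain ⟨a, rfl⟩ := Ideal.Quotient.mk_surjective t
  exact this a

/-- nonzero right ideals contain nonzero idempotents -/
theorem exists_idem (hwf : WellFounded (RP A)) (hJ : Ring.jacobson A = ⊥) (K : Set A)
    (hK : ∀ x ∈ K, ∀ c, x * c ∈ K) (hne : ∃ x ∈ K, x ≠ 0) :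
    ∃ e ∈ K, e ≠ 0 ∧ e * e = e := by
  obtain ⟨a, ⟨haK, ha0⟩, hmin⟩ := hwf.has_min {x | x ∈ K ∧ x ≠ 0} hne
  have hm : ∀ c, a * c ≠ 0 → ∃ d, a = a * c * d := by
    intro c hc
    by_contra hn
    exact hmin (a * c) ⟨hK a haK c, hc⟩ ⟨⟨c, rfl⟩, hn⟩
  obtain ⟨x, hx⟩ : ∃ x, a * x * a ≠ 0 := by
    by_contra! hall
    apply ha0
    have : a ∈ Ring.jacobson A := by
      rw [mem_jac]
      intro y
      refine ⟨1 - y * a, ?_⟩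
      have h1 : y * a * (y * a) = 0 := by
        rw [mul_assoc, ← mul_assoc a, hall, mul_zero]
      rw [sub_mul, mul_add, mul_add, h1]; simp
    rw [hJ] at this
    simpa using this
  -- left multiplication by `b = a * x` is bijective on `a A`
  obtain ⟨d, hd⟩ := hm (x * a) (by rwa [← mul_assoc])
  -- `a = a x a d`
  have hd' : a * x * a * d = a := by
    rw [mul_assoc a x a]; exact hd.symm
  have hinj : ∀ c, a * x * (a * c) = 0 → a * c = 0 := by
    intro c hc
    by_contra hne
    obtain ⟨v, hv⟩ := hm c hne
    apply hx
    calc a * x * a = a * x * (a * c * v) := by rw [← hv]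
      _ = 0 := by rw [← mul_assoc, hc, zero_mul]
  refine ⟨a * (d * x), hK a haK _, ?_, ?_⟩
  · intro h0
    apply hx
    have h1 : a * x = a * x * (a * (d * x)) := by
      rw [← mul_assoc, ← mul_assoc, hd']
    rw [h1, h0, mul_zero, zero_mul]
  · have h1 : a * x * (a * (d * x)) = a * x := by
      rw [← mul_assoc, ← mul_assoc, hd']
    have h2 := hinj (d * x * (a * (d * x)) - d * x) (by
      rw [mul_sub, mul_sub, h1, ← mul_assoc a, ← mul_assoc (a * x), h1, h1, sub_self])
    rw [mul_sub, sub_eq_zero, ← mul_assoc] at h2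
    exact h2

theorem semisimple_op (hwf : WellFounded (RP A)) (hJ : Ring.jacobson A = ⊥) :
    IsSemisimpleRing Aᵐᵒᵖ := by
  have hmain : ∀ K : Ideal Aᵐᵒᵖ, ∃ e : A, MulOpposite.op e ∈ K ∧
      ∀ x, MulOpposite.op x ∈ K → e * x = x := by
    intro K
    have hKr : ∀ x, MulOpposite.op x ∈ K → ∀ c, MulOpposite.op (x * c) ∈ K := fun x hx c => by
      rw [MulOpposite.op_mul]; exact K.mul_mem_left _ hx
    obtain ⟨g, ⟨e, heK, hee, rfl⟩, hmin⟩ := hwf.has_min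
      {g | ∃ e : A, MulOpposite.op e ∈ K ∧ e * e = e ∧ g = 1 - e} ⟨1, 0, by simp, by simp, by simp⟩
    refine ⟨e, heK, ?_⟩
    by_contra! hcon
    obtain ⟨x, hxK, hx⟩ := hcon
    obtain ⟨f, ⟨hfK, hef⟩, hf0, hff⟩ := exists_idem hwf hJ
      {y | MulOpposite.op y ∈ K ∧ e * y = 0}
      (fun y hy c => ⟨hKr y hy.1 c, by rw [← mul_assoc, hy.2, zero_mul]⟩)
      ⟨x - e * x, ⟨by
        rw [MulOpposite.op_sub]
        exact K.sub_mem hxK (hKr e heK x), by rw [mul_sub, ← mul_assoc, hee, sub_self]⟩,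
        fun h => hx (sub_eq_zero.1 h).symm⟩
    have h1 : (e + f - f * e) * e = e := by
      rw [sub_mul, add_mul, mul_assoc, hee]; abel
    have h2 : (e + f - f * e) * f = f := by
      rw [sub_mul, add_mul, mul_assoc, hef, hff]; simp
    refine hmin (1 - (e + f - f * e)) ⟨e + f - f * e, ?_, ?_, rfl⟩ ⟨⟨1 - f + f * e, ?_⟩, ?_⟩
    · rw [MulOpposite.op_sub, MulOpposite.op_add]
      exact K.sub_mem (K.add_mem heK hfK) (hKr f hfK e)
    · rw [mul_sub, mul_add, ← mul_assoc, h1, h2]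
    · have h3 : e * (f * e) = 0 := by rw [← mul_assoc, hef, zero_mul]
      rw [sub_mul, one_mul, mul_add, mul_sub, mul_one, h3, hef]; abel
    · rintro ⟨c, hc⟩
      apply hf0
      have h4 : (e + f - f * e) * (1 - e) = 0 := by
        rw [hc, ← mul_assoc, mul_sub, mul_one]
        have : (e + f - f * e) * (e + f - f * e) = e + f - f * e := by
          rw [mul_sub, mul_add, ← mul_assoc, h1, h2]
        rw [this, sub_self, zero_mul]
      have h5 : (1 - e) * f = f := by rw [sub_mul, one_mul, hef, sub_zero]
      calc f = (e + f - f * e) * f := h2.symm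
        _ = (e + f - f * e) * ((1 - e) * f) := by rw [h5]
        _ = 0 := by rw [← mul_assoc, h4, zero_mul]
  refine (isSemisimpleModule_iff _ _).2 ⟨fun K => ?_⟩
  obtain ⟨e, heK, he⟩ := hmain K
  refine ⟨Ideal.span {MulOpposite.op (1 - e)}, ?_⟩
  constructor
  · rw [Submodule.disjoint_def]
    intro x hxK hx
    obtain ⟨s, rfl⟩ := Ideal.mem_span_singleton'.1 hx
    have hee := he e heK
    have h1 := he ((1 - e) * s.unop) (by simpa using hxK)
    rw [← mul_assoc, mul_sub, mul_one, hee, sub_self, zero_mul] at h1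
    apply MulOpposite.unop_injective
    rw [MulOpposite.unop_mul, MulOpposite.unop_op, ← h1, MulOpposite.unop_zero]
  · rw [codisjoint_iff, Ideal.eq_top_iff_one]
    have : (1 : Aᵐᵒᵖ) = MulOpposite.op e + MulOpposite.op (1 - e) := by
      rw [← MulOpposite.op_add]; simp
    rw [this]
    exact Submodule.add_mem_sup heK (Ideal.subset_span rfl)

theorem artinian (hN : IsNoetherianRing A) (hA : Module.Injective A A) : IsArtinianRing A := by
  have hwf := wf_RP hN hA
  have hs : IsSemisimpleRing (A ⧸ Ring.jacobson A) :=
    isSemisimpleRing_mulOpposite_iff.1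
      (semisimple_op (wf_quot _ hwf) (Ring.jacobson_quotient_jacobson A))
  have : IsSemiprimaryRing A := ⟨hs, jac_nilp hN hwf⟩
  exact IsSemiprimaryRing.isNoetherian_iff_isArtinian.1 hN

end Semiprimary


section Final

variable {R : Type u} [Ring R]

/-- right annihilator of a left ideal -/
def rAnn (K : Ideal R) : Ideal Rᵐᵒᵖ where
  carrier := {s | ∀ x ∈ K, x * s.unop = 0}
  add_mem' := fun {a b} ha hb x hx => by
    rw [MulOpposite.unop_add, mul_add, ha x hx, hb x hx, add_zero]
  zero_mem' := fun x _ => by simp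
  smul_mem' := fun c a ha x hx => by
    rw [smul_eq_mul, MulOpposite.unop_mul, ← mul_assoc, ha x hx, zero_mul]

/-- left annihilator of a right ideal -/
def lAnn (I : Ideal Rᵐᵒᵖ) : Ideal R where
  carrier := {a | ∀ s ∈ I, a * s.unop = 0}
  add_mem' := fun {a b} ha hb x hx => by rw [add_mul, ha x hx, hb x hx, add_zero]
  zero_mem' := fun x _ => by simp
  smul_mem' := fun c a ha x hx => by rw [smul_eq_mul, mul_assoc, ha x hx, mul_zero]

theorem mem_rAnn {K : Ideal R} {s : Rᵐᵒᵖ} : s ∈ rAnn K ↔ ∀ x ∈ K, x * s.unop = 0 := Iff.rfl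

theorem mem_lAnn {I : Ideal Rᵐᵒᵖ} {a : R} : a ∈ lAnn I ↔ ∀ s ∈ I, a * s.unop = 0 := Iff.rfl

theorem mem_rAnn_span {t : Set R} {s : Rᵐᵒᵖ} :
    s ∈ rAnn (Ideal.span t) ↔ ∀ x ∈ t, x * s.unop = 0 := by
  refine ⟨fun h x hx => h x (Ideal.subset_span hx), fun h => ?_⟩
  have : Ideal.span t ≤ LinearMap.ker (LinearMap.toSpanSingleton R R s.unop) := by
    rw [Ideal.span_le]
    intro x hx
    simpa using h x hx
  intro x hx
  simpa using this hx

theorem cycEmb_op (h1 : IsNoetherianRing R) (h2 : IsNoetherianRing Rᵐᵒᵖ)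
    (h3 : Module.Injective R R) : CycEmb Rᵐᵒᵖ := by
  classical
  intro I
  obtain ⟨t, ht⟩ := h1.noetherian (lAnn I)
  obtain ⟨u, hu⟩ := h2.noetherian I
  refine ⟨t.image MulOpposite.op, fun a => ?_⟩
  have h4 : (∀ x ∈ t.image MulOpposite.op, a * x = 0) ↔ a ∈ rAnn (lAnn I) := by
    rw [← ht]
    refine Iff.trans ?_ (mem_rAnn_span (t := (t : Set R))).symm
    simp only [Finset.mem_image, forall_exists_index, and_imp, forall_apply_eq_imp_iff₂,
      Finset.mem_coe]
    refine forall_congr' fun x => forall_congr' fun _ => ?_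
    rw [← MulOpposite.unop_injective.eq_iff]
    simp
  rw [h4]
  constructor
  · intro ha x hx
    exact hx a ha
  · intro ha
    obtain ⟨c, hc⟩ := ann_fg h3 (u.image MulOpposite.unop) a.unop (by
      intro b hb
      apply ha
      have : I ≤ rAnn (Ideal.span {b}) := by
        rw [← hu]
        refine Submodule.span_le.2 fun s hs => ?_
        refine mem_rAnn_span.2 ?_
        rintro x rfl
        exact hb _ (Finset.mem_image_of_mem _ hs)
      intro s hs
      exact this hs b (Ideal.subset_span rfl))
    have h5 : a = ∑ x ∈ u.image MulOpposite.unop, MulOpposite.op (c x) * MulOpposite.op x := by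
      apply MulOpposite.unop_injective
      rw [hc, Finset.unop_sum]
      simp
    rw [h5]
    refine I.sum_mem fun x hx => I.mul_mem_left _ ?_
    obtain ⟨s, hs, rfl⟩ := Finset.mem_image.1 hx
    rw [← hu, MulOpposite.op_unop]
    exact Submodule.subset_span hs

theorem lr_fg (hA : Module.Injective Rᵐᵒᵖ Rᵐᵒᵖ) {K : Ideal R} (hK : K.FG) {y : R}
    (h : ∀ s ∈ rAnn K, y * s.unop = 0) : y ∈ K := by
  classical
  obtain ⟨t, rfl⟩ := hK
  obtain ⟨c, hc⟩ := ann_fg hA (t.image MulOpposite.op) (MulOpposite.op y) (by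
    intro a ha
    have h1 := h a (mem_rAnn_span.2 fun x hx => by
      have := ha _ (Finset.mem_image_of_mem _ hx)
      simpa using congrArg MulOpposite.unop this)
    apply MulOpposite.unop_injective
    simpa using h1)
  have h5 : y = ∑ x ∈ t.image MulOpposite.op, (c x).unop * x.unop := by
    have := congrArg MulOpposite.unop hc
    rw [Finset.unop_sum] at this
    simpa using this
  rw [h5]
  refine Submodule.sum_mem _ fun x hx => Ideal.mul_mem_left _ _ ?_
  obtain ⟨s, hs, rfl⟩ := Finset.mem_image.1 hx
  exact Submodule.subset_span hs

theorem rl_all (hC : CycEmb Rᵐᵒᵖ) {I : Ideal Rᵐᵒᵖ} {s : Rᵐᵒᵖ}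
    (h : ∀ a ∈ lAnn I, a * s.unop = 0) : s ∈ I := by
  obtain ⟨t, ht⟩ := hC I
  rw [ht]
  intro x hx
  apply MulOpposite.unop_injective
  rw [MulOpposite.unop_mul, MulOpposite.unop_zero]
  apply h
  intro v hv
  simpa using congrArg MulOpposite.unop ((ht v).1 hv x hx)

theorem rAnn_anti {K L : Ideal R} (h : K ≤ L) : rAnn L ≤ rAnn K := fun _ hs x hx => hs x (h hx)

theorem noeth_R (hN : IsNoetherianRing Rᵐᵒᵖ) (hA : Module.Injective Rᵐᵒᵖ Rᵐᵒᵖ) :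
    IsNoetherianRing R := by
  have hart := artinian hN hA
  rw [isNoetherianRing_iff_ideal_fg]
  intro K
  have hwf : WellFounded ((· < ·) : Ideal Rᵐᵒᵖ → Ideal Rᵐᵒᵖ → Prop) := wellFounded_lt
  obtain ⟨I, ⟨L, hLK, hL, rfl⟩, hmin⟩ := hwf.has_min
    {I | ∃ L : Ideal R, L ≤ K ∧ L.FG ∧ I = rAnn L} ⟨_, ⊥, bot_le, Submodule.fg_bot, rfl⟩
  suffices K ≤ L by rwa [le_antisymm this hLK]
  intro x hx
  have hfg : (L ⊔ Ideal.span {x}).FG := Submodule.FG.sup hL (Submodule.fg_span_singleton x)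
  have hle : L ⊔ Ideal.span {x} ≤ K := sup_le hLK (by simpa [Ideal.span_le] using hx)
  have h1 := hmin _ ⟨_, hle, hfg, rfl⟩
  have h2 : rAnn L ≤ rAnn (L ⊔ Ideal.span {x}) := by
    by_contra hn
    exact h1 (lt_of_le_not_ge (rAnn_anti le_sup_left) hn)
  apply lr_fg hA hL
  intro s hs
  exact h2 hs x ((le_sup_right : _ ≤ L ⊔ Ideal.span {x}) (Ideal.subset_span rfl))

theorem inj_R (hN : IsNoetherianRing R) (hA : Module.Injective Rᵐᵒᵖ Rᵐᵒᵖ) (hC : CycEmb Rᵐᵒᵖ) :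
    Module.Injective R R := by
  apply Module.Baer.injective
  have key : ∀ (K : Ideal R) (_ : K.FG), ∀ g : K →ₗ[R] R, ∃ c : R, ∀ (x : R) (hx : x ∈ K),
      g ⟨x, hx⟩ = x * c := by
    intro K hK
    induction K, hK using Submodule.fg_induction with
    | singleton x =>
      intro g
      have hx : x ∈ Submodule.span R {x} := Submodule.mem_span_singleton_self x
      have h1 : MulOpposite.op (g ⟨x, hx⟩) ∈ Ideal.span {MulOpposite.op x} := by
        apply rl_all hC
        intro a ha
        have h2 : a * x = 0 := ha _ (Ideal.subset_span rfl)
        have h3 : a • (⟨x, hx⟩ : Submodule.span R {x}) = 0 := Subtype.ext h2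
        rw [MulOpposite.unop_op, ← smul_eq_mul, ← map_smul, h3, map_zero]
      obtain ⟨c, hc⟩ := Ideal.mem_span_singleton'.1 h1
      refine ⟨c.unop, fun y hy => ?_⟩
      obtain ⟨a, rfl⟩ := Submodule.mem_span_singleton.1 hy
      have h4 : (⟨a • x, hy⟩ : Submodule.span R {x}) = a • ⟨x, hx⟩ := rfl
      have h5 := congrArg MulOpposite.unop hc
      simp only [MulOpposite.unop_mul, MulOpposite.unop_op] at h5
      rw [h4, map_smul, ← h5, smul_eq_mul, smul_eq_mul, mul_assoc]
    | sup K L _ _ ihK ihL =>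
      intro g
      obtain ⟨a, ha⟩ := ihK (g.comp (Submodule.inclusion le_sup_left))
      obtain ⟨b, hb⟩ := ihL (g.comp (Submodule.inclusion le_sup_right))
      have h1 : MulOpposite.op (a - b) ∈ rAnn K ⊔ rAnn L := by
        apply rl_all hC
        intro x hx
        have hxK : x ∈ K := lr_fg hA (hN.noetherian K) fun s hs =>
          hx s ((le_sup_left : _ ≤ rAnn K ⊔ rAnn L) hs)
        have hxL : x ∈ L := lr_fg hA (hN.noetherian L) fun s hs =>
          hx s ((le_sup_right : _ ≤ rAnn K ⊔ rAnn L) hs)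
        rw [MulOpposite.unop_op, mul_sub, ← ha x hxK, ← hb x hxL]
        exact sub_self _
      obtain ⟨u, hu, v, hv, huv⟩ := Submodule.mem_sup.1 h1
      have h2 : u.unop + v.unop = a - b := by
        simpa using congrArg MulOpposite.unop huv
      refine ⟨a - u.unop, fun x hx => ?_⟩
      obtain ⟨y, hy, z, hz, rfl⟩ := Submodule.mem_sup.1 hx
      have h3 : g ⟨y + z, hx⟩ = g (Submodule.inclusion le_sup_left ⟨y, hy⟩) +
          g (Submodule.inclusion le_sup_right ⟨z, hz⟩) := by
        rw [← map_add]; rfl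
      have h4 : g (Submodule.inclusion le_sup_left ⟨y, hy⟩) = y * a := ha y hy
      have h5 : g (Submodule.inclusion le_sup_right ⟨z, hz⟩) = z * b := hb z hz
      have h6 : y * u.unop = 0 := hu y hy
      have h7 : z * v.unop = 0 := hv z hz
      have h8 : a - u.unop = b + v.unop := by
        rw [sub_eq_iff_eq_add, add_assoc, add_comm v.unop, h2]; abel
      rw [h3, h4, h5, add_mul]
      nth_rewrite 2 [h8]
      rw [mul_sub, mul_add, h6, h7, sub_zero, add_zero]
  intro K g
  obtain ⟨c, hc⟩ := key K (hN.noetherian K) g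
  exact ⟨LinearMap.toSpanSingleton R R c, fun x hx => by rw [hc x hx]; simp⟩

end Final

end QFProof


/-- `R` is quasi-Frobenius (left and right Noetherian, and left and right self-injective)
if and only if the right Gorenstein global dimension of `R` is zero. -/
theorem quasiFrobenius_iff_right_GPgldim_eq_zero (R : Type u) [Ring R] :
    (IsNoetherianRing R ∧ IsNoetherianRing Rᵐᵒᵖ ∧
      Module.Injective R R ∧ Module.Injective Rᵐᵒᵖ Rᵐᵒᵖ) ↔ GPgldim Rᵐᵒᵖ = 0 := by
  constructor
  · rintro ⟨h1, h2, h3, h4⟩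
    exact QFProof.gldim_of_gp fun M _ _ =>
      QFProof.gp_of_qf h2 h4 (QFProof.cycEmb_op h1 h2 h3) M
  · intro h
    have hgp := fun (M : Type u) [AddCommGroup M] [Module Rᵐᵒᵖ M] => QFProof.gp_of_gldim h M
    have h2 := QFProof.noeth_of_gp hgp
    have h4 : Module.Injective Rᵐᵒᵖ Rᵐᵒᵖ := QFProof.inj_of_gp hgp _ inferInstance
    have h1 := QFProof.noeth_R h2 h4
    exact ⟨h1, h2, QFProof.inj_R h1 h4 (QFProof.cycEmb_of_gp hgp), h4⟩
end

section
/- Assume the left Gorenstein global dimension of R is at most n for some non-negative integer n. If an R-module M has finite projective dimension, then pd_R(M) ≤ n, id_R(M) ≤ n, and fd_R(M) ≤ n. -/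
/-! Definitions for Gorenstein homological algebra over an arbitrary
associative ring `R` (left modules; right modules are `Rᵐᵒᵖ`-modules). -/

universe u

section Tensor

open TensorProduct

variable (R : Type u) [Ring R]

/-- The defining relations of the tensor product `N ⊗_R M` of a right `R`-module `N`
and a left `R`-module `M`, inside the tensor product of abelian groups `N ⊗[ℤ] M`. -/
noncomputable def tensorRel (N : Type u) [AddCommGroup N] [Module Rᵐᵒᵖ N]
    (M : Type u) [AddCommGroup M] [Module R M] : AddSubgroup (N ⊗[ℤ] M) :=
  AddSubgroup.closure {x | ∃ (r : R) (n : N) (m : M),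
    x = (MulOpposite.op r • n) ⊗ₜ[ℤ] m - n ⊗ₜ[ℤ] (r • m)}

/-- The tensor product `N ⊗_R M` (an abelian group) of a right `R`-module `N` and a
left `R`-module `M` over the (possibly noncommutative) ring `R`. -/
abbrev bTensor (N : Type u) [AddCommGroup N] [Module Rᵐᵒᵖ N]
    (M : Type u) [AddCommGroup M] [Module R M] : Type u :=
  (N ⊗[ℤ] M) ⧸ tensorRel R N M

/-- The map `N ⊗_R M →+ N ⊗_R M'` induced by a map `f : M →ₗ[R] M'` of left modules. -/
noncomputable def tmapRight (N : Type u) [AddCommGroup N] [Module Rᵐᵒᵖ N]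
    {M M' : Type u} [AddCommGroup M] [Module R M] [AddCommGroup M'] [Module R M']
    (f : M →ₗ[R] M') : bTensor R N M →+ bTensor R N M' :=
  QuotientAddGroup.map _ _ (LinearMap.lTensor N (f.restrictScalars ℤ)).toAddMonoidHom <| by
    rw [tensorRel, AddSubgroup.closure_le]
    rintro x ⟨r, n, m, rfl⟩
    simp only [AddSubgroup.coe_comap, Set.mem_preimage, LinearMap.toAddMonoidHom_coe,
      map_sub, LinearMap.lTensor_tmul, SetLike.mem_coe]
    refine AddSubgroup.subset_closure ⟨r, n, f m, ?_⟩
    simp [LinearMap.map_smul]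

/-- The map `N ⊗_R M →+ N' ⊗_R M` induced by a map `g : N →ₗ[Rᵐᵒᵖ] N'` of right modules. -/
noncomputable def tmapLeft {N N' : Type u} [AddCommGroup N] [Module Rᵐᵒᵖ N]
    [AddCommGroup N'] [Module Rᵐᵒᵖ N']
    (M : Type u) [AddCommGroup M] [Module R M]
    (g : N →ₗ[Rᵐᵒᵖ] N') : bTensor R N M →+ bTensor R N' M :=
  QuotientAddGroup.map _ _ (LinearMap.rTensor M (g.restrictScalars ℤ)).toAddMonoidHom <| by
    rw [tensorRel, AddSubgroup.closure_le]
    rintro x ⟨r, n, m, rfl⟩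
    simp only [AddSubgroup.coe_comap, Set.mem_preimage, LinearMap.toAddMonoidHom_coe,
      map_sub, LinearMap.rTensor_tmul, SetLike.mem_coe]
    refine AddSubgroup.subset_closure ⟨r, g n, m, ?_⟩
    simp [LinearMap.map_smul]

/-- A left `R`-module `M` is flat if `- ⊗_R M` preserves injectivity of maps of right
`R`-modules. -/
def ModFlat (M : Type u) [AddCommGroup M] [Module R M] : Prop :=
  ∀ (N N' : Type u) (_ : AddCommGroup N) (_ : Module Rᵐᵒᵖ N)
    (_ : AddCommGroup N') (_ : Module Rᵐᵒᵖ N') (g : N →ₗ[Rᵐᵒᵖ] N'),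
      Function.Injective g → Function.Injective (tmapLeft R M g)

/-- `M` is Gorenstein flat: it is the kernel of a map in a doubly infinite exact complex
of flat modules which stays exact under `E ⊗_R -` for every injective right `R`-module `E`. -/
def GorensteinFlat (M : Type u) [AddCommGroup M] [Module R M] : Prop :=
  ∃ (F : ℤ → Type u) (_ : ∀ i, AddCommGroup (F i)) (_ : ∀ i, Module R (F i))
    (d : ∀ i, F i →ₗ[R] F (i + 1)),
      (∀ i, ModFlat R (F i)) ∧
      (∀ i, Function.Exact (d i) (d (i + 1))) ∧
      Nonempty (M ≃ₗ[R] LinearMap.ker (d 0)) ∧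
      (∀ (E : Type u) (_ : AddCommGroup E) (_ : Module Rᵐᵒᵖ E), Module.Injective Rᵐᵒᵖ E →
        ∀ i, Function.Exact (tmapRight R E (d i)) (tmapRight R E (d (i + 1))))

/-- Flat dimension, valued in `ℕ∞`. -/
noncomputable def fDim (M : Type u) [AddCommGroup M] [Module R M] : ℕ∞ :=
  sInf ((↑) '' {n : ℕ | HasLeftResolutionLE R (fun N _ _ => ModFlat R N) M n})

/-- Gorenstein flat dimension, valued in `ℕ∞`. -/
noncomputable def gfDim (M : Type u) [AddCommGroup M] [Module R M] : ℕ∞ :=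
  sInf ((↑) '' {n : ℕ | HasLeftResolutionLE R (fun N _ _ => GorensteinFlat R N) M n})

/-- The weak global dimension of `R`. -/
noncomputable def wgldim : ℕ∞ :=
  sSup {d : ℕ∞ | ∃ (M : Type u) (_ : AddCommGroup M) (_ : Module R M), d = fDim R M}

/-- The left weak Gorenstein global dimension of `R`: `sup { Gfd_R(M) }`. -/
noncomputable def GFgldim : ℕ∞ :=
  sSup {d : ℕ∞ | ∃ (M : Type u) (_ : AddCommGroup M) (_ : Module R M), d = gfDim R M}

end Tensor

section Helpers

open CategoryTheory CategoryTheory.Abelian TensorProduct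

variable {R : Type u} [Ring R]

/-- Vanishing of `Ext^k_R(X, Y)`. -/
def ExtVanish (R : Type u) [Ring R] (k : ℕ) (X Y : Type u) [AddCommGroup X] [Module R X]
    [AddCommGroup Y] [Module R Y] : Prop :=
  Subsingleton (Ext (ModuleCat.of R X) (ModuleCat.of R Y) k)

section Ext

variable {A B C Y : Type u} [AddCommGroup A] [Module R A] [AddCommGroup B] [Module R B]
  [AddCommGroup C] [Module R C] [AddCommGroup Y] [Module R Y]

lemma IsSES.comp_zero {f : A →ₗ[R] B} {g : B →ₗ[R] C} (h : IsSES R f g) : g.comp f = 0 :=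
  h.2.1.linearMap_comp_eq_zero

lemma IsSES.shortExact {f : A →ₗ[R] B} {g : B →ₗ[R] C} (h : IsSES R f g) :
    (ModuleCat.shortComplexOfCompEqZero f g h.comp_zero).ShortExact :=
  ModuleCat.shortComplex_shortExact _ h.2.1 h.1 h.2.2

lemma isSES_ker (g : B →ₗ[R] C) (hg : Function.Surjective g) :
    IsSES R (LinearMap.ker g).subtype g :=
  ⟨Subtype.val_injective, g.exact_subtype_ker_map, hg⟩

lemma ext_cov {f : A →ₗ[R] B} {g : B →ₗ[R] C} (h : IsSES R f g) {k : ℕ}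
    (hB : ExtVanish R k Y B) (hA : ExtVanish R (k + 1) Y A) : ExtVanish R k Y C := by
  have key : ∀ x : Ext (ModuleCat.of R Y) (ModuleCat.of R C) k, x = 0 := by
    intro x
    obtain ⟨y, hy⟩ := Ext.covariant_sequence_exact₃ (ModuleCat.of R Y) h.shortExact x rfl
      (hA.elim _ _)
    have : y = 0 := hB.elim _ _
    rw [← hy, this, Ext.zero_comp]
  exact ⟨fun x y => by rw [key x, key y]⟩

lemma ext_contra {f : A →ₗ[R] B} {g : B →ₗ[R] C} (h : IsSES R f g) {k : ℕ}
    (hA : ExtVanish R k A Y) (hB : ExtVanish R (k + 1) B Y) : ExtVanish R (k + 1) C Y := by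
  have key : ∀ x : Ext (ModuleCat.of R C) (ModuleCat.of R Y) (k + 1), x = 0 := by
    intro x
    obtain ⟨y, hy⟩ := Ext.contravariant_sequence_exact₃ h.shortExact (ModuleCat.of R Y) x
      (hB.elim _ _) (add_comm 1 k)
    have : y = 0 := hA.elim _ _
    rw [← hy, this, Ext.comp_zero]
  exact ⟨fun x y => by rw [key x, key y]⟩

lemma ext_one_contra {f : A →ₗ[R] B} {g : B →ₗ[R] C} (h : IsSES R f g)
    (hA : ∀ φ : A →ₗ[R] Y, ∃ ψ : B →ₗ[R] Y, ψ.comp f = φ) (hB : ExtVanish R 1 B Y) :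
    ExtVanish R 1 C Y := by
  have key : ∀ x : Ext (ModuleCat.of R C) (ModuleCat.of R Y) 1, x = 0 := by
    intro x
    obtain ⟨y, hy⟩ := Ext.contravariant_sequence_exact₃ h.shortExact (ModuleCat.of R Y) x
      (hB.elim _ _) (add_comm 1 0)
    obtain ⟨φ, rfl⟩ := Ext.homEquiv₀.symm.surjective y
    obtain ⟨ψ, hψ⟩ := hA φ.hom
    have e : φ = (ModuleCat.shortComplexOfCompEqZero f g h.comp_zero).f ≫ ModuleCat.ofHom ψ := by
      ext a
      simp [← hψ]
    rw [← hy, e, Ext.homEquiv₀_symm_apply, ← Ext.mk₀_comp_mk₀]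
    exact h.shortExact.extClass_comp_assoc _
  exact ⟨fun x y => by rw [key x, key y]⟩

lemma ext_proj (hP : Module.Projective R A) (k : ℕ) : ExtVanish R (k + 1) A Y := by
  have : Projective (ModuleCat.of R A) := (IsProjective.iff_projective A).1 hP
  exact HasProjectiveDimensionLT.subsingleton (ModuleCat.of R A) 1 (k + 1) (by omega) _

lemma ext_zero_left [Subsingleton A] (k : ℕ) : ExtVanish R k A Y := by
  have : HasProjectiveDimensionLT (ModuleCat.of R A) 0 :=
    (ModuleCat.isZero_of_subsingleton _).hasProjectiveDimensionLT_zero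
  exact HasProjectiveDimensionLT.subsingleton (ModuleCat.of R A) 0 k (by omega) _

lemma ext_zero_right [Subsingleton A] (k : ℕ) : ExtVanish R k Y A := by
  have : HasInjectiveDimensionLT (ModuleCat.of R A) 0 :=
    (ModuleCat.isZero_of_subsingleton _).hasInjectiveDimensionLT_zero
  exact HasInjectiveDimensionLT.subsingleton (ModuleCat.of R A) 0 k (by omega) _

lemma ext_equiv_left (e : A ≃ₗ[R] B) {k : ℕ} (h : ExtVanish R (k + 1) B Y) :
    ExtVanish R (k + 1) A Y := by
  refine ext_contra (A := PUnit.{u + 1}) (B := B) (f := 0) (g := e.symm.toLinearMap) ⟨?_, ?_, ?_⟩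
    (ext_zero_left _) h
  · exact Function.injective_of_subsingleton _
  · intro x
    simp only [LinearEquiv.coe_coe, LinearEquiv.map_eq_zero_iff]
    exact ⟨fun hx => ⟨0, by simp [hx]⟩, fun ⟨y, hy⟩ => by simpa using hy.symm⟩
  · exact e.symm.surjective

end Ext

section Gor

lemma ext_gp {G Q : Type u} [AddCommGroup G] [Module R G] [AddCommGroup Q] [Module R Q]
    (hG : GorensteinProjective R G) (hQ : Module.Projective R Q) (k : ℕ) :
    ExtVanish R (k + 1) G Q := by
  obtain ⟨P, _, _, d, hP, hd, ⟨e⟩, hHom⟩ := hG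
  have ses : ∀ i, IsSES R (LinearMap.ker (d i)).subtype
      ((d i).codRestrict (LinearMap.ker (d (i + 1))) fun x => (hd i).apply_apply_eq_zero x) := by
    intro i
    refine ⟨Subtype.val_injective, ?_, ?_⟩
    · intro x
      rw [Subtype.ext_iff]
      exact ⟨fun hx => ⟨⟨x, hx⟩, rfl⟩, fun ⟨y, hy⟩ => hy ▸ y.2⟩
    · rintro ⟨x, hx⟩
      obtain ⟨y, rfl⟩ := (hd i x).1 hx
      exact ⟨y, rfl⟩
  have main : ∀ k i, ExtVanish R (k + 1) (LinearMap.ker (d i)) Q := by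
    intro k
    induction k with
    | zero =>
      intro j
      obtain ⟨i, rfl⟩ : ∃ i : ℤ, j = i + 1 + 1 + 1 := ⟨j - 3, by ring⟩
      refine ext_one_contra (ses (i + 1 + 1)) ?_ (ext_proj (hP _) 0)
      intro φ
      let c := (d (i + 1)).codRestrict (LinearMap.ker (d (i + 1 + 1)))
        fun x => (hd (i + 1)).apply_apply_eq_zero x
      obtain ⟨ψ, hψ⟩ := (hHom Q _ _ hQ i (φ.comp c)).1 (by
        ext x
        have : c (d i x) = 0 := Subtype.ext ((hd i).apply_apply_eq_zero x)
        simp [this])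
      refine ⟨ψ, ?_⟩
      ext ⟨x, hx⟩
      obtain ⟨y, rfl⟩ := (hd (i + 1) x).1 hx
      exact LinearMap.congr_fun hψ y
    | succ k ih =>
      intro j
      obtain ⟨i, rfl⟩ : ∃ i : ℤ, j = i + 1 := ⟨j - 1, by ring⟩
      exact ext_contra (ses i) (ih i) (ext_proj (hP _) _)
  exact ext_equiv_left e (main k 0)

end Gor

section Res

variable {𝒢 : ∀ (N : Type u) [AddCommGroup N] [Module R N], Prop}

lemma leftRes_cases {M : Type u} [AddCommGroup M] [Module R M] {n : ℕ}
    (h : HasLeftResolutionLE R 𝒢 M n) :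
    ∃ (G : Type u) (_ : AddCommGroup G) (_ : Module R G) (π : G →ₗ[R] M), 𝒢 G ∧
      Function.Surjective π ∧ (n = 0 → Subsingleton (LinearMap.ker π)) ∧
      (∀ k, n = k + 1 → HasLeftResolutionLE R 𝒢 (LinearMap.ker π) k) := by
  obtain ⟨G, _, _, d, π, hG, hn, hπ, h0, hd⟩ := h
  refine ⟨G 0, inferInstance, inferInstance, π, hG 0, hπ, ?_, ?_⟩
  · rintro rfl
    have := hn 1 (by omega)
    refine ⟨?_⟩
    have key : ∀ x : LinearMap.ker π, x = 0 := by
      rintro ⟨x, hx⟩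
      obtain ⟨y, rfl⟩ := (h0 x).1 hx
      apply Subtype.ext
      have : y = 0 := Subsingleton.elim (α := G 1) _ _
      simp [this]
    intro a b
    rw [key a, key b]
  · rintro k rfl
    refine ⟨fun i => G (i + 1), inferInstance, inferInstance, fun i => d (i + 1),
      (d 0).codRestrict (LinearMap.ker π) (fun x => h0.apply_apply_eq_zero x),
      fun i => hG _, fun i hi => hn _ (by omega), ?_, ?_, fun i => hd _⟩
    · rintro ⟨x, hx⟩
      obtain ⟨y, rfl⟩ := (h0 x).1 hx
      exact ⟨y, rfl⟩
    · intro x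
      rw [← hd 0 x, Subtype.ext_iff]
      exact Iff.rfl

lemma leftRes_zero {M : Type u} [AddCommGroup M] [Module R M] (h : 𝒢 M) (h0 : 𝒢 PUnit.{u + 1}) :
    HasLeftResolutionLE R 𝒢 M 0 := by
  refine ⟨fun i => Nat.rec M (fun _ _ => PUnit) i,
    fun i => Nat.rec (by dsimp only; infer_instance) (fun _ _ => by dsimp only; infer_instance) i,
    fun i => Nat.rec (by dsimp only; infer_instance) (fun _ _ => by dsimp only; infer_instance) i,
    fun i => 0, LinearMap.id, ?_, ?_, ?_, ?_, ?_⟩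
  · rintro (_ | i)
    · exact h
    · exact h0
  · rintro (_ | i) hi
    · omega
    · exact inferInstanceAs (Subsingleton PUnit)
  · exact Function.surjective_id
  · intro x
    constructor
    · intro hx
      exact ⟨PUnit.unit, hx.symm⟩
    · rintro ⟨y, rfl⟩
      rfl
  · rintro i x
    exact ⟨fun _ => ⟨PUnit.unit, rfl⟩, fun _ => rfl⟩

/-- Prepend a module to a sequence of modules. -/
def consT (G : Type u) (K : ℕ → Type u) (i : ℕ) : Type u :=
  Nat.casesOn i G K

instance consTGroup (G : Type u) (K : ℕ → Type u) [i1 : AddCommGroup G]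
    [i2 : ∀ i, AddCommGroup (K i)] (i : ℕ) : AddCommGroup (consT G K i) :=
  Nat.casesOn i i1 i2

instance consTModule (G : Type u) (K : ℕ → Type u) [AddCommGroup G]
    [∀ i, AddCommGroup (K i)] [m1 : Module R G] [m2 : ∀ i, Module R (K i)] (i : ℕ) :
    Module R (consT G K i) :=
  match i with
  | 0 => m1
  | i + 1 => m2 i

/-- Prepend a map to a chain of maps. -/
def consL {G : Type u} {K : ℕ → Type u} [AddCommGroup G]
    [∀ i, AddCommGroup (K i)] [Module R G] [∀ i, Module R (K i)] (f : K 0 →ₗ[R] G)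
    (d : ∀ i, K (i + 1) →ₗ[R] K i) (i : ℕ) : consT G K (i + 1) →ₗ[R] consT G K i :=
  match i with
  | 0 => f
  | i + 1 => d i

/-- Prepend a map to a cochain of maps. -/
def consR {G : Type u} {K : ℕ → Type u} [AddCommGroup G]
    [∀ i, AddCommGroup (K i)] [Module R G] [∀ i, Module R (K i)] (f : G →ₗ[R] K 0)
    (d : ∀ i, K i →ₗ[R] K (i + 1)) (i : ℕ) : consT G K i →ₗ[R] consT G K (i + 1) :=
  match i with
  | 0 => f
  | i + 1 => d i

lemma leftRes_succ {M G : Type u} [AddCommGroup M] [Module R M] [AddCommGroup G] [Module R G]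
    (π : G →ₗ[R] M) (hπ : Function.Surjective π) (h : 𝒢 G) {n : ℕ}
    (hK : HasLeftResolutionLE R 𝒢 (LinearMap.ker π) n) :
    HasLeftResolutionLE R 𝒢 M (n + 1) := by
  obtain ⟨K, iK, mK, d, ρ, hKi, hn, hρ, h0, hd⟩ := hK
  refine ⟨consT G K, inferInstance, inferInstance,
    consL ((LinearMap.ker π).subtype.comp ρ) d, π, ?_, ?_, hπ, ?_, ?_⟩
  · rintro (_ | i)
    · exact h
    · exact hKi i
  · rintro (_ | i) hi
    · omega
    · exact hn i (by omega)
  · intro x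
    constructor
    · intro hx
      obtain ⟨y, hy⟩ := hρ ⟨x, hx⟩
      exact ⟨y, congrArg Subtype.val hy⟩
    · rintro ⟨y, rfl⟩
      exact (ρ y).2
  · rintro (_ | i)
    · intro x
      refine Iff.trans ?_ (h0 x)
      exact ⟨fun hx => Subtype.ext hx, fun hx => congrArg Subtype.val hx⟩
    · exact hd i

lemma rightRes_zero {M : Type u} [AddCommGroup M] [Module R M] (h : 𝒢 M) (h0 : 𝒢 PUnit.{u + 1}) :
    HasRightResolutionLE R 𝒢 M 0 := by
  refine ⟨fun i => Nat.rec M (fun _ _ => PUnit) i,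
    fun i => Nat.rec (by dsimp only; infer_instance) (fun _ _ => by dsimp only; infer_instance) i,
    fun i => Nat.rec (by dsimp only; infer_instance) (fun _ _ => by dsimp only; infer_instance) i,
    fun i => 0, LinearMap.id, ?_, ?_, ?_, ?_, ?_⟩
  · rintro (_ | i)
    · exact h
    · exact h0
  · rintro (_ | i) hi
    · omega
    · exact inferInstanceAs (Subsingleton PUnit)
  · exact Function.injective_id
  · intro x
    exact ⟨fun _ => ⟨x, rfl⟩, fun _ => rfl⟩
  · rintro (_ | i) x
    · exact ⟨fun _ => ⟨(0 : M), rfl⟩, fun _ => rfl⟩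
    · exact ⟨fun _ => ⟨PUnit.unit, rfl⟩, fun _ => rfl⟩

lemma rightRes_succ {M G C : Type u} [AddCommGroup M] [Module R M] [AddCommGroup G] [Module R G]
    [AddCommGroup C] [Module R C]
    (f : M →ₗ[R] G) (g : G →ₗ[R] C) (hs : IsSES R f g) (h : 𝒢 G) {n : ℕ}
    (hK : HasRightResolutionLE R 𝒢 C n) :
    HasRightResolutionLE R 𝒢 M (n + 1) := by
  obtain ⟨K, iK, mK, d, ρ, hKi, hn, hρ, h0, hd⟩ := hK
  refine ⟨consT G K, inferInstance, inferInstance, consR (ρ.comp g) d, f, ?_, ?_, hs.1, ?_, ?_⟩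
  · rintro (_ | i)
    · exact h
    · exact hKi i
  · rintro (_ | i) hi
    · omega
    · exact hn i (by omega)
  · intro x
    refine Iff.trans ?_ (hs.2.1 x)
    constructor
    · intro hx
      exact hρ (Eq.trans hx (map_zero ρ).symm)
    · intro hx
      exact Eq.trans (congrArg ρ hx) (map_zero ρ)
  · rintro (_ | i)
    · intro x
      refine Iff.trans (h0 x) ?_
      constructor
      · rintro ⟨c, rfl⟩
        obtain ⟨y, rfl⟩ := hs.2.2 c
        exact ⟨y, rfl⟩
      · rintro ⟨y, rfl⟩
        exact ⟨g y, rfl⟩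
    · exact hd i

end Res

section Dim

/-- `Ext^{>0}(G, M) = 0` for `G` Gorenstein projective, `M` of finite projective dimension. -/
lemma ext_gp_pd {G : Type u} [AddCommGroup G] [Module R G] (hG : GorensteinProjective R G)
    (m : ℕ) : ∀ (M : Type u) [AddCommGroup M] [Module R M],
    HasLeftResolutionLE R (fun N _ _ => Module.Projective R N) M m →
    ∀ k, ExtVanish R (k + 1) G M := by
  induction m with
  | zero =>
    intro M _ _ h k
    obtain ⟨P, _, _, π, hP, hπ, h0, -⟩ := leftRes_cases h
    have := h0 rfl
    exact ext_cov (isSES_ker π hπ) (ext_gp hG hP k) (ext_zero_right _)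
  | succ m ih =>
    intro M _ _ h k
    obtain ⟨P, _, _, π, hP, hπ, -, h1⟩ := leftRes_cases h
    exact ext_cov (isSES_ker π hπ) (ext_gp hG hP k) (ih _ (h1 m rfl) (k + 1))

lemma ext_gpd {M : Type u} [AddCommGroup M] [Module R M]
    (hM : ∀ (G : Type u) [AddCommGroup G] [Module R G], GorensteinProjective R G →
      ∀ k, ExtVanish R (k + 1) G M) (n : ℕ) :
    ∀ (N : Type u) [AddCommGroup N] [Module R N],
    HasLeftResolutionLE R (fun N _ _ => GorensteinProjective R N) N n →
    ∀ k, ExtVanish R (n + k + 1) N M := by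
  induction n with
  | zero =>
    intro N _ _ h k
    obtain ⟨P, _, _, π, hP, hπ, h0, -⟩ := leftRes_cases h
    have := h0 rfl
    exact ext_contra (isSES_ker π hπ) (ext_zero_left _) (hM _ hP _)
  | succ n ih =>
    intro N _ _ h k
    obtain ⟨P, _, _, π, hP, hπ, -, h1⟩ := leftRes_cases h
    have := ih _ (h1 n rfl) k
    have e : n + 1 + k + 1 = (n + k + 1) + 1 := by ring
    rw [e]
    exact ext_contra (isSES_ker π hπ) this (hM _ hP _)

lemma hasPD_of_leftRes (m : ℕ) : ∀ (M : Type u) [AddCommGroup M] [Module R M],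
    HasLeftResolutionLE R (fun N _ _ => Module.Projective R N) M m →
    ∀ (Y : Type u) [AddCommGroup Y] [Module R Y], ExtVanish R (m + 1) M Y := by
  induction m with
  | zero =>
    intro M _ _ h Y _ _
    obtain ⟨P, _, _, π, hP, hπ, h0, -⟩ := leftRes_cases h
    have := h0 rfl
    exact ext_contra (isSES_ker π hπ) (ext_zero_left _) (ext_proj hP _)
  | succ m ih =>
    intro M _ _ h Y _ _
    obtain ⟨P, _, _, π, hP, hπ, -, h1⟩ := leftRes_cases h
    exact ext_contra (isSES_ker π hπ) (ih _ (h1 m rfl) Y) (ext_proj hP _)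

lemma exists_proj_cover (Y : Type u) [AddCommGroup Y] [Module R Y] :
    ∃ (P : Type u) (_ : AddCommGroup P) (_ : Module R P) (π : P →ₗ[R] Y),
      Module.Projective R P ∧ Function.Surjective π :=
  ⟨Y →₀ R, inferInstance, inferInstance, Finsupp.linearCombination R id, inferInstance,
    Finsupp.linearCombination_id_surjective R Y⟩

/-- If `Ext^{n+1}(M, P) = 0` for `> n` and `P` projective, `pd M` finite, then `pd M ≤ n`. -/
lemma ext_descend {M : Type u} [AddCommGroup M] [Module R M] {n : ℕ}
    (hP : ∀ (P : Type u) [AddCommGroup P] [Module R P], Module.Projective R P →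
      ∀ k, ExtVanish R (n + k + 1) M P) (j : ℕ)
    (hj : ∀ (Y : Type u) [AddCommGroup Y] [Module R Y], ExtVanish R (n + j + 1) M Y) :
    ∀ (Y : Type u) [AddCommGroup Y] [Module R Y], ExtVanish R (n + 1) M Y := by
  induction j with
  | zero => exact hj
  | succ j ih =>
    apply ih
    intro Y _ _
    obtain ⟨P, _, _, π, hPP, hπ⟩ := exists_proj_cover (R := R) Y
    exact ext_cov (isSES_ker π hπ) (hP P hPP j) (hj _)

lemma leftRes_of_hasPD (n : ℕ) : ∀ (M : Type u) [AddCommGroup M] [Module R M],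
    HasProjectiveDimensionLT (ModuleCat.of R M) (n + 1) →
    HasLeftResolutionLE R (fun N _ _ => Module.Projective R N) M n := by
  induction n with
  | zero =>
    intro M _ _ h
    refine leftRes_zero ?_ ?_
    · rw [IsProjective.iff_projective]
      exact projective_iff_hasProjectiveDimensionLT_one.2 h
    · infer_instance
  | succ n ih =>
    intro M _ _ h
    obtain ⟨P, _, _, π, hPP, hπ⟩ := exists_proj_cover (R := R) M
    refine leftRes_succ π hπ hPP (ih _ ?_)
    have := (IsProjective.iff_projective P).1 hPP
    exact ((isSES_ker π hπ).shortExact.hasProjectiveDimensionLT_X₃_iff n this).1 h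

lemma rightRes_of_hasID (n : ℕ) : ∀ (M : Type u) [AddCommGroup M] [Module R M],
    HasInjectiveDimensionLT (ModuleCat.of R M) (n + 1) →
    HasRightResolutionLE R (fun N _ _ => Module.Injective R N) M n := by
  induction n with
  | zero =>
    intro M _ _ h
    refine rightRes_zero ?_ ?_
    · rw [Module.injective_iff_injective_object]
      exact injective_iff_hasInjectiveDimensionLT_one.2 h
    · exact ⟨fun _ _ _ _ _ _ _ _ _ => ⟨0, fun _ => rfl⟩⟩
  | succ n ih =>
    intro M _ _ h
    obtain ⟨⟨J, hJ, f, hf⟩⟩ := EnoughInjectives.presentation (ModuleCat.of R M)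
    have hs : IsSES R f.hom (LinearMap.range f.hom).mkQ :=
      ⟨(ModuleCat.mono_iff_injective f).1 hf, LinearMap.exact_map_mkQ_range _,
        Submodule.mkQ_surjective _⟩
    have hJ' : Module.Injective R J := by
      rw [Module.injective_iff_injective_object]
      exact hJ
    refine rightRes_succ _ _ hs hJ' (ih _ ?_)
    exact (hs.shortExact.hasInjectiveDimensionLT_X₃_iff n hJ).2 h

end Dim

section Flat

/-- The map `N ⊗_R M → (M →₀ N)` induced by `s : M → (M →₀ R)`. -/
noncomputable def phiAux (N : Type u) [AddCommGroup N] [Module Rᵐᵒᵖ N]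
    {M : Type u} [AddCommGroup M] [Module R M] (s : M →ₗ[R] (M →₀ R)) :
    N ⊗[ℤ] M →ₗ[ℤ] (M →₀ N) :=
  TensorProduct.lift (AddMonoidHom.toIntLinearMap
    { toFun := fun n => AddMonoidHom.toIntLinearMap
        ((Finsupp.mapRange.addMonoidHom
          { toFun := fun r : R => MulOpposite.op r • n
            map_zero' := by simp
            map_add' := by intro a b; simp [add_smul] }).comp s.toAddMonoidHom)
      map_zero' := by ext m x; simp
      map_add' := by intro a b; ext m x; simp })

lemma phiAux_tmul (N : Type u) [AddCommGroup N] [Module Rᵐᵒᵖ N]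
    {M : Type u} [AddCommGroup M] [Module R M] (s : M →ₗ[R] (M →₀ R)) (n : N) (m x : M) :
    phiAux N s (n ⊗ₜ[ℤ] m) x = MulOpposite.op (s m x) • n := by
  rfl

lemma phiAux_rel (N : Type u) [AddCommGroup N] [Module Rᵐᵒᵖ N]
    {M : Type u} [AddCommGroup M] [Module R M] (s : M →ₗ[R] (M →₀ R)) :
    tensorRel R N M ≤ (phiAux N s).toAddMonoidHom.ker := by
  rw [tensorRel, AddSubgroup.closure_le]
  rintro x ⟨r, n, m, rfl⟩
  change phiAux N s ((MulOpposite.op r • n) ⊗ₜ[ℤ] m - n ⊗ₜ[ℤ] (r • m)) = 0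
  ext x
  simp [phiAux_tmul, smul_smul]

noncomputable def psiAux (N : Type u) [AddCommGroup N] [Module Rᵐᵒᵖ N]
    (M : Type u) [AddCommGroup M] [Module R M] : (M →₀ N) →+ bTensor R N M :=
  Finsupp.liftAddHom fun x => (QuotientAddGroup.mk' (tensorRel R N M)).comp
    ((TensorProduct.mk ℤ N M).flip x).toAddMonoidHom

lemma psi_phi (N : Type u) [AddCommGroup N] [Module Rᵐᵒᵖ N]
    {M : Type u} [AddCommGroup M] [Module R M] (s : M →ₗ[R] (M →₀ R))
    (hs : ∀ m, Finsupp.linearCombination R id (s m) = m) (t : N ⊗[ℤ] M) :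
    psiAux (R := R) N M (phiAux N s t) = QuotientAddGroup.mk' (tensorRel R N M) t := by
  induction t with
  | zero => simp
  | add a b ha hb => rw [map_add, map_add, map_add, ha, hb]
  | tmul n m =>
    have key : ∀ f : M →₀ R, psiAux (R := R) N M
        (Finsupp.mapRange (fun r : R => MulOpposite.op r • n) (by simp) f) =
        QuotientAddGroup.mk' (tensorRel R N M)
          (n ⊗ₜ[ℤ] (Finsupp.linearCombination R id f)) := by
      intro f
      induction f using Finsupp.induction_linear with
      | zero => simp
      | add f g hf hg =>
        rw [Finsupp.mapRange_add (by intro a b; simp [add_smul]), map_add, hf, hg, map_add,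
          TensorProduct.tmul_add, map_add]
      | single x r =>
        simp only [Finsupp.mapRange_single, psiAux, Finsupp.liftAddHom_apply_single,
          Finsupp.linearCombination_single, id]
        refine (QuotientAddGroup.eq_iff_sub_mem).2 ?_
        exact AddSubgroup.subset_closure ⟨r, n, x, rfl⟩
    have e : phiAux N s (n ⊗ₜ[ℤ] m) =
        Finsupp.mapRange (fun r : R => MulOpposite.op r • n) (by simp) (s m) := by
      ext x
      simp [phiAux_tmul]
    rw [e, key, hs]

lemma modFlat_of_projective {M : Type u} [AddCommGroup M] [Module R M]
    (hM : Module.Projective R M) : ModFlat R M := by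
  obtain ⟨s, hs⟩ := hM.out
  intro N N' _ _ _ _ g hg
  rw [injective_iff_map_eq_zero]
  intro a ha
  obtain ⟨t, rfl⟩ := QuotientAddGroup.mk'_surjective (tensorRel R N M) a
  have h1 : LinearMap.rTensor M (g.restrictScalars ℤ) t ∈ tensorRel R N' M :=
    (QuotientAddGroup.eq_zero_iff _).1 ha
  have h2 : phiAux N' s (LinearMap.rTensor M (g.restrictScalars ℤ) t) = 0 :=
    phiAux_rel N' s h1
  have h3 : ∀ (t : N ⊗[ℤ] M) x,
      phiAux N' s (LinearMap.rTensor M (g.restrictScalars ℤ) t) x = g (phiAux N s t x) := by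
    intro t x
    induction t with
    | zero => simp
    | add a b ha hb => simp only [map_add, Finsupp.add_apply, ha, hb]
    | tmul n m => simp [phiAux_tmul]
  have h4 : phiAux N s t = 0 := by
    ext x
    apply hg
    rw [← h3, h2]
    simp
  rw [← psi_phi N s hs, h4, map_zero]

end Flat

lemma exists_of_sInf_le {S : Set ℕ} {n : ℕ}
    (h : sInf ((fun k : ℕ => (k : ℕ∞)) '' S) ≤ (n : ℕ∞)) : ∃ m ∈ S, m ≤ n := by
  by_cases hS : S.Nonempty
  · obtain ⟨m, hm, e⟩ := csInf_mem (hS.image (fun k : ℕ => (k : ℕ∞)))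
    refine ⟨m, hm, ?_⟩
    rw [← e] at h
    exact Nat.cast_le.1 h
  · rw [Set.not_nonempty_iff_eq_empty.1 hS] at h
    simp at h

lemma leftRes_mono {𝒢 : ∀ (N : Type u) [AddCommGroup N] [Module R N], Prop}
    {M : Type u} [AddCommGroup M] [Module R M] {m n : ℕ} (hmn : m ≤ n)
    (h : HasLeftResolutionLE R 𝒢 M m) : HasLeftResolutionLE R 𝒢 M n := by
  obtain ⟨G, i1, i2, d, π, hG, hn, hrest⟩ := h
  exact ⟨G, i1, i2, d, π, hG, fun i hi => hn i (by omega), hrest⟩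

end Helpers

/-- If `l.Ggldim(R) ≤ n` and `M` has finite projective dimension, then
`pd_R(M) ≤ n`, `id_R(M) ≤ n` and `fd_R(M) ≤ n`. -/
theorem dims_le_of_pDim_finite (R : Type u) [Ring R] (n : ℕ) (h : GPgldim R ≤ n)
    (M : Type u) [AddCommGroup M] [Module R M] (hM : pDim R M ≠ ⊤) :
    pDim R M ≤ n ∧ iDim R M ≤ n ∧ fDim R M ≤ n := by
  have hgp : ∀ (N : Type u) [AddCommGroup N] [Module R N],
      HasLeftResolutionLE R (fun N _ _ => GorensteinProjective R N) N n := by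
    intro N _ _
    have h1 : gpDim R N ≤ n := by
      refine le_trans (le_sSup ?_) h
      exact ⟨N, inferInstance, inferInstance, rfl⟩
    obtain ⟨m, hm, hmn⟩ := exists_of_sInf_le h1
    exact leftRes_mono hmn hm
  obtain ⟨m, hm⟩ : ∃ m, HasLeftResolutionLE R (fun N _ _ => Module.Projective R N) M m := by
    obtain ⟨p, hp⟩ := ENat.ne_top_iff_exists.1 hM
    obtain ⟨m, hm, -⟩ := exists_of_sInf_le (n := p) (le_of_eq hp.symm)
    exact ⟨m, hm⟩
  -- injective dimension of modules of finite projective dimension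
  have hid : ∀ (m : ℕ) (M : Type u) [AddCommGroup M] [Module R M],
      HasLeftResolutionLE R (fun N _ _ => Module.Projective R N) M m →
      ∀ (N : Type u) [AddCommGroup N] [Module R N] (k : ℕ), ExtVanish R (n + k + 1) N M := by
    intro m M _ _ hm N _ _ k
    exact ext_gpd (fun G _ _ hG => ext_gp_pd hG m M hm) n N (hgp N) k
  have hi : HasRightResolutionLE R (fun N _ _ => Module.Injective R N) M n :=
    rightRes_of_hasID n M (CategoryTheory.hasInjectiveDimensionLT_of_enoughProjectives _ _
      fun Y => hid m M hm Y 0)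
  have hp : HasLeftResolutionLE R (fun N _ _ => Module.Projective R N) M n := by
    refine leftRes_of_hasPD n M (CategoryTheory.hasProjectiveDimensionLT_of_enoughInjectives _ _
      fun Y => ext_descend (n := n) (fun P _ _ hP k => hid 0 P (leftRes_zero hP inferInstance) M k)
        m (hasPD_of_leftRes (n + m) M (leftRes_mono (by omega) hm)) Y)
  refine ⟨sInf_le ⟨n, hp, rfl⟩, sInf_le ⟨n, hi, rfl⟩, sInf_le ⟨n, ?_, rfl⟩⟩
  obtain ⟨G, i1, i2, d, π, hG, hrest⟩ := hp
  exact ⟨G, i1, i2, d, π, fun i => modFlat_of_projective (hG i), hrest⟩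
end
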